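/- arXiv:2502.16067 — 2 statements merged into one kernel-verified Lean document; each statement's English description precedes it below -/
import Mathlib

section
/- (Functional equation of the Estermann function over 𝔽_q[T].) Let g ∈ 𝔽_q[T] be monic of degree ≥ 1 and c ∈ 𝔽_q[T] with gcd(c,g) = 1, and let c̄ be any multiplicative inverse of c modulo g. Then for every u ∈ ℂ with 0 < |u| < 1/q, D_2(u;c/g) = (qu²)^{deg g − 1} · Σ_{λ ∈ 𝔽_q^×} A_λ(u) · D_2(1/(qu); λc̄/g), where A_λ(u) = Kl_2(−1,λ)/q + (1 + q − 2qu)/(q(1 − qu)²) and D_2(·;λc̄/g) is evaluated via its rational continuation; equivalently, the identity holds as an equality of rational functions of u. -/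
open Polynomial
open scoped Classical

noncomputable section

/-- The canonical additive character of a finite field `F`:
`e_q(y) = exp(2πi·Tr(y)/p)` where `p` is the characteristic. -/
def eChar (F : Type) [Field F] [Fintype F] (y : F) : ℂ :=
  letI : Algebra (ZMod (ringChar F)) F := ZMod.algebra F (ringChar F)
  Complex.exp (2 * Real.pi * Complex.I *
    ((Algebra.trace (ZMod (ringChar F)) F y).val : ℂ) / (ringChar F : ℂ))

variable {F : Type} [Field F] [Fintype F]

/-- `e(a/g) = e_q(coefficient of T^(deg g - 1) of (a mod g))`. -/
def eFrac (a g : Polynomial F) : ℂ :=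
  eChar F ((a % g).coeff (g.natDegree - 1))

/-- Number of monic divisors of a polynomial. -/
def dCount (f : Polynomial F) : ℕ :=
  Set.ncard {g : Polynomial F | g.Monic ∧ g ∣ f}

/-- `r_χ(f) = Σ_{g monic, g ∣ f} χ(g)`. -/
def rChi (χ : Polynomial F → ℂ) (f : Polynomial F) : ℂ :=
  ∑ᶠ g ∈ {g : Polynomial F | g.Monic ∧ g ∣ f}, χ g

/-- A Dirichlet character modulo `ℓ`: a function induced by a group homomorphism
`(F[T]/(ℓ))^× → ℂ^×`, extended by zero on non-coprime arguments. -/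
def IsDirichletChar (ℓ : Polynomial F) (χ : Polynomial F → ℂ) : Prop :=
  (∀ f g : Polynomial F, f % ℓ = g % ℓ → χ f = χ g) ∧
  (∀ f g : Polynomial F, χ (f * g) = χ f * χ g) ∧ χ 1 = 1 ∧
  ∀ f : Polynomial F, χ f = 0 ↔ ¬ IsCoprime f ℓ

/-- Primitivity: `χ` is not induced by a character modulo a proper (monic) divisor of `ℓ`. -/
def IsPrimitiveChar (ℓ : Polynomial F) (χ : Polynomial F → ℂ) : Prop :=
  IsDirichletChar ℓ χ ∧
  ∀ ℓ' : Polynomial F, ℓ'.Monic → ℓ' ∣ ℓ → ℓ' ≠ ℓ →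
    ¬ ∃ χ' : Polynomial F → ℂ, IsDirichletChar ℓ' χ' ∧
      ∀ f : Polynomial F, IsCoprime f ℓ → χ f = χ' f

/-- Complex conjugate character. -/
def conjChar (χ : Polynomial F → ℂ) : Polynomial F → ℂ := fun f => starRingEnd ℂ (χ f)

/-- `L(s,χ) = Σ_{f monic} χ(f)|f|^{-s}`, summed by degree. -/
def LFun (χ : Polynomial F → ℂ) (s : ℂ) : ℂ :=
  ∑' n : ℕ, (∑ᶠ f ∈ {f : Polynomial F | f.Monic ∧ f.natDegree = n}, χ f) *
    (Fintype.card F : ℂ) ^ (-(s * (n : ℂ)))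

/-- Gauss sum `G(χ) = Σ_{deg a < deg ℓ} χ(a)·e(a/ℓ)`. -/
def GSum (ℓ : Polynomial F) (χ : Polynomial F → ℂ) : ℂ :=
  ∑ᶠ a ∈ {a : Polynomial F | a.degree < ℓ.degree}, χ a * eFrac a ℓ

/-- Kloosterman sum over `F`. -/
def Kl2 (α β : F) : ℂ :=
  ∑ γ : Fˣ, eChar F (α * (γ : F) + β * ((γ⁻¹ : Fˣ) : F))

/-- Twisted Kloosterman sum over `F`. -/
def KlChi (χ : Polynomial F → ℂ) (α β : F) : ℂ :=
  ∑ γ : Fˣ, χ (Polynomial.C (γ : F)) * eChar F (α * (γ : F) + β * ((γ⁻¹ : Fˣ) : F))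

/-- Gauss sum of the restriction of `χ` to `F`. -/
def tauChi (χ : Polynomial F → ℂ) (α : F) : ℂ :=
  ∑ γ : Fˣ, χ (Polynomial.C (γ : F)) * eChar F (α * (γ : F))

/-- Generalized binomial coefficient `C(-m, j)`. -/
def negBinom (m j : ℕ) : ℤ :=
  if m = 0 then (if j = 0 then 1 else 0) else (-1) ^ j * (Nat.choose (m + j - 1) j)

/-- The coefficients `b_k(χ; λ, η₁, η₂)` of the Voronoi summation formula. -/
def bCoeff (χ : Polynomial F → ℂ) (lam : F) (η₁ η₂ k : ℕ) : ℂ :=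
  (-1 : ℂ) ^ (k - η₁ - η₂) * KlChi χ ((η₁ : F) - 1) ((1 - (η₂ : F)) * lam) *
    (if η₁ + η₂ ≤ k then (negBinom (η₁ + η₂) (k - η₁ - η₂) : ℂ) else 0)

/-- The untwisted coefficients `b_k(λ, η₁, η₂)`. -/
def bCoeffD (lam : F) (η₁ η₂ k : ℕ) : ℂ :=
  (-1 : ℂ) ^ (k - η₁ - η₂) * Kl2 ((η₁ : F) - 1) ((1 - (η₂ : F)) * lam) *
    (if η₁ + η₂ ≤ k then (negBinom (η₁ + η₂) (k - η₁ - η₂) : ℂ) else 0)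

/-- The series `Σ_{f monic} c(f)·u^{deg f}` (as a `tsum`). -/
def monicSeries (c : Polynomial F → ℂ) (u : ℂ) : ℂ :=
  ∑' f : {f : Polynomial F // f.Monic}, c f * u ^ (f : Polynomial F).natDegree

/-- `φ` is the rational continuation of the series `u ↦ Σ_{f monic} c(f)·u^{deg f}`:
it agrees with the (convergent) series on `‖u‖ < 1/q` and is a rational function. -/
def IsRatCont (c : Polynomial F → ℂ) (φ : ℂ → ℂ) : Prop :=
  (∃ P Q : Polynomial ℂ, IsCoprime P Q ∧ Q ≠ 0 ∧
    ∀ z : ℂ, Q.eval z ≠ 0 → φ z = P.eval z / Q.eval z) ∧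
  ∀ u : ℂ, ‖u‖ < 1 / (Fintype.card F) →
    HasSum (fun f : {f : Polynomial F // f.Monic} => c f * u ^ (f : Polynomial F).natDegree)
      (φ u)

end

section AdditiveCharacter

variable (F : Type) [Field F] [Fintype F]

theorem exists_addChar_eq_eChar :
    ∃ ψ : AddChar F ℂ, (∀ y, ψ y = eChar F y) ∧ ψ ≠ 1 := by
  let _ : Algebra (ZMod (ringChar F)) F := ZMod.algebra F (ringChar F)
  have : NeZero (ringChar F) := ⟨CharP.ringChar_ne_zero_of_finite F⟩
  have hval : ∀ y, ZMod.stdAddChar (Algebra.trace (ZMod (ringChar F)) F y) = eChar F y := by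
    intro y
    rw [ZMod.stdAddChar_apply, ZMod.toCircle_apply]
    rfl
  refine ⟨ZMod.stdAddChar.compAddMonoidHom
    (Algebra.trace (ZMod (ringChar F)) F).toAddMonoidHom, hval, ?_⟩
  obtain ⟨b, hb⟩ := FiniteField.trace_to_zmod_nondegenerate F (one_ne_zero (α := F))
  rw [one_mul] at hb
  obtain ⟨s, hs⟩ := AddChar.ne_one_iff.1 (ZMod.isPrimitive_stdAddChar (ringChar F) hb)
  rw [AddChar.mulShift_apply] at hs
  have : Fact (ringChar F).Prime := ⟨CharP.char_is_prime F _⟩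
  refine AddChar.ne_one_iff.2 ⟨s • b, ?_⟩
  rw [AddChar.compAddMonoidHom_apply]
  change ZMod.stdAddChar (Algebra.trace (ZMod (ringChar F)) F (s • b)) ≠ 1
  rwa [map_smul, smul_eq_mul, mul_comm]

/-- `eChar` as an additive character. -/
noncomputable def eAddChar : AddChar F ℂ := (exists_addChar_eq_eChar F).choose

theorem eAddChar_apply (y : F) : eAddChar F y = eChar F y :=
  (exists_addChar_eq_eChar F).choose_spec.1 y

theorem eAddChar_ne_one : eAddChar F ≠ 1 :=
  (exists_addChar_eq_eChar F).choose_spec.2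

theorem sum_units_eAddChar : ∑ α : Fˣ, eAddChar F (α : F) = -1 := by
  have h := AddChar.sum_eq_zero_of_ne_one (eAddChar_ne_one F)
  have h2 : ∑ a : F, eAddChar F a = eAddChar F 0 + ∑ α : Fˣ, eAddChar F (α : F) := by
    rw [← Finset.add_sum_erase _ _ (Finset.mem_univ (0 : F))]
    congr 1
    refine (Finset.sum_bij (fun (α : Fˣ) _ => (α : F)) (by simp) (by simp [Units.ext_iff])
      (fun b hb => ⟨Units.mk0 b (by simpa using hb), by simp⟩) (by simp)).symm
  rw [h, AddChar.map_zero_eq_one] at h2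
  linear_combination -h2

end AdditiveCharacter

section Residues

variable {F : Type} [Field F] {g : F[X]}

theorem mk_modByMonicHom (hg : g.Monic) (x : AdjoinRoot g) :
    AdjoinRoot.mk g (AdjoinRoot.modByMonicHom hg x) = x :=
  AdjoinRoot.mk_leftInverse hg x

theorem modByMonicHom_eq_zero_iff (hg : g.Monic) {x : AdjoinRoot g} :
    AdjoinRoot.modByMonicHom hg x = 0 ↔ x = 0 := by
  refine ⟨fun h => ?_, fun h => by simp [h]⟩
  rw [← mk_modByMonicHom hg x, h, map_zero]

theorem degree_modByMonicHom_lt (hg : g.Monic) (x : AdjoinRoot g) :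
    (AdjoinRoot.modByMonicHom hg x).degree < g.degree := by
  rw [← mk_modByMonicHom hg x, AdjoinRoot.modByMonicHom_mk]
  exact degree_modByMonic_lt _ hg

theorem natDegree_modByMonicHom_lt (hg : g.Monic) {x : AdjoinRoot g} (hx : x ≠ 0) :
    (AdjoinRoot.modByMonicHom hg x).natDegree < g.natDegree :=
  natDegree_lt_natDegree (mt (modByMonicHom_eq_zero_iff hg).1 hx) (degree_modByMonicHom_lt hg x)

variable [Fintype F]

instance finite_degreeLT (n : ℕ) : Finite (degreeLT F n) :=
  Finite.of_equiv _ (degreeLTEquiv F n).toEquiv.symm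

noncomputable instance fintype_degreeLT (n : ℕ) : Fintype (degreeLT F n) := Fintype.ofFinite _

theorem card_degreeLT (n : ℕ) : Fintype.card (degreeLT F n) = Fintype.card F ^ n := by
  rw [Fintype.card_congr (degreeLTEquiv F n).toEquiv]
  simp

/-- The additive character of `F[X] / (g)` induced by `a ↦ e(a / g)`. -/
noncomputable def fracChar (hg : g.Monic) : AddChar (AdjoinRoot g) ℂ :=
  (eAddChar F).compAddMonoidHom
    ((lcoeff F (g.natDegree - 1)) ∘ₗ (AdjoinRoot.modByMonicHom hg)).toAddMonoidHom

theorem fracChar_apply (hg : g.Monic) (x : AdjoinRoot g) :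
    fracChar hg x = eAddChar F ((AdjoinRoot.modByMonicHom hg x).coeff (g.natDegree - 1)) := rfl

theorem fracChar_mk (hg : g.Monic) (a : F[X]) :
    fracChar hg (AdjoinRoot.mk g a) = eFrac a g := by
  rw [fracChar_apply, AdjoinRoot.modByMonicHom_mk, modByMonic_eq_mod _ hg, eAddChar_apply, eFrac]

theorem fracChar_mk_mul (hg : g.Monic) (a : F[X]) (x : AdjoinRoot g)
    (h : (a * AdjoinRoot.modByMonicHom hg x).degree < g.degree) :
    fracChar hg (AdjoinRoot.mk g a * x) =
      eAddChar F ((a * AdjoinRoot.modByMonicHom hg x).coeff (g.natDegree - 1)) := by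
  conv_lhs => rw [← mk_modByMonicHom hg x, ← map_mul]
  rw [fracChar_apply, AdjoinRoot.modByMonicHom_mk, (modByMonic_eq_self_iff hg).2 h]

theorem fracChar_C_mul_X_pow_mul (hg : g.Monic) {x : AdjoinRoot g} (hx : x ≠ 0) (γ : F) {k : ℕ}
    (hk : k + (AdjoinRoot.modByMonicHom hg x).natDegree + 1 = g.natDegree) :
    fracChar hg (AdjoinRoot.mk g (C γ * X ^ k) * x) =
      eAddChar F (γ * (AdjoinRoot.modByMonicHom hg x).leadingCoeff) := by
  have hp := mt (modByMonicHom_eq_zero_iff hg).1 hx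
  rw [fracChar_mk_mul]
  · congr 1
    rw [mul_assoc, coeff_C_mul, show g.natDegree - 1 =
      (AdjoinRoot.modByMonicHom hg x).natDegree + k by omega, coeff_X_pow_mul]
    rfl
  · rw [degree_eq_natDegree hg.ne_zero]
    refine lt_of_le_of_lt (degree_mul_le _ _) ?_
    refine lt_of_le_of_lt (add_le_add (degree_C_mul_X_pow_le k γ) degree_le_natDegree) ?_
    exact_mod_cast (by omega)

theorem fracChar_isPrimitive (hg : g.Monic) : (fracChar hg).IsPrimitive := by
  intro x hx
  have hp := mt (modByMonicHom_eq_zero_iff hg).1 hx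
  have hd := natDegree_modByMonicHom_lt hg hx
  obtain ⟨γ, hγ⟩ := AddChar.ne_one_iff.1 (eAddChar_ne_one F)
  refine AddChar.ne_one_iff.2 ⟨AdjoinRoot.mk g
    (C (γ * ((AdjoinRoot.modByMonicHom hg x).leadingCoeff)⁻¹) *
      X ^ (g.natDegree - 1 - (AdjoinRoot.modByMonicHom hg x).natDegree)), ?_⟩
  rw [AddChar.mulShift_apply, mul_comm, fracChar_C_mul_X_pow_mul hg hx _ (by omega),
    inv_mul_cancel_right₀ (leadingCoeff_ne_zero.2 hp)]
  exact hγ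

theorem norm_fracChar (hg : g.Monic) (x : AdjoinRoot g) : ‖fracChar hg x‖ = 1 := by
  have := hg.finite_adjoinRoot
  have : Finite (AdjoinRoot g) := Module.finite_of_finite F
  exact AddChar.norm_apply _ _

/-- The sum of `e(a x / g)` over monic `a` of degree `n`. -/
noncomputable def monicCharSum (hg : g.Monic) (x : AdjoinRoot g) (n : ℕ) : ℂ :=
  ∑ b : degreeLT F n, fracChar hg (AdjoinRoot.mk g (X ^ n + (b : F[X])) * x)

theorem monicCharSum_eq_zero (hg : g.Monic) {x : AdjoinRoot g} (hx : x ≠ 0) {n : ℕ}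
    (hn : g.natDegree ≤ n + (AdjoinRoot.modByMonicHom hg x).natDegree) :
    monicCharSum hg x n = 0 := by
  have hp := mt (modByMonicHom_eq_zero_iff hg).1 hx
  have hd := natDegree_modByMonicHom_lt hg hx
  obtain ⟨γ, hγ⟩ := AddChar.ne_one_iff.1 (eAddChar_ne_one F)
  set k := g.natDegree - 1 - (AdjoinRoot.modByMonicHom hg x).natDegree with hk
  let b₀ : degreeLT F n := ⟨C (γ * ((AdjoinRoot.modByMonicHom hg x).leadingCoeff)⁻¹) * X ^ k, by
    rw [mem_degreeLT]
    refine lt_of_le_of_lt (degree_C_mul_X_pow_le _ _) ?_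
    exact_mod_cast (by omega)⟩
  have hb₀ : fracChar hg (AdjoinRoot.mk g (b₀ : F[X]) * x) = eAddChar F γ := by
    change fracChar hg (AdjoinRoot.mk g (C _ * X ^ k) * x) = _
    rw [fracChar_C_mul_X_pow_mul hg hx _ (by omega),
      inv_mul_cancel_right₀ (leadingCoeff_ne_zero.2 hp)]
  have h : monicCharSum hg x n = eAddChar F γ * monicCharSum hg x n := by
    conv_lhs => rw [monicCharSum, ← Equiv.sum_comp (Equiv.addRight b₀)]
    rw [monicCharSum, Finset.mul_sum]
    refine Finset.sum_congr rfl fun b _ => ?_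
    rw [← hb₀, ← AddChar.map_add_eq_mul]
    congr 1
    simp only [Equiv.coe_addRight, Submodule.coe_add, map_add]
    ring
  have h' : (eAddChar F γ - 1) * monicCharSum hg x n = 0 := by linear_combination -h
  exact (mul_eq_zero.1 h').resolve_left (sub_ne_zero.2 hγ)

theorem fracChar_eq_one (hg : g.Monic) {x : AdjoinRoot g} {b : F[X]} {n : ℕ}
    (hb : b.degree < n) (hn : n + (AdjoinRoot.modByMonicHom hg x).natDegree < g.natDegree) :
    fracChar hg (AdjoinRoot.mk g b * x) = 1 := by
  have hlt : (b * AdjoinRoot.modByMonicHom hg x).degree < (g.natDegree - 1 : ℕ) := by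
    by_cases hb0 : b = 0
    · simp [hb0]
    by_cases hp : AdjoinRoot.modByMonicHom hg x = 0
    · simp [hp]
    rw [← natDegree_lt_iff_degree_lt hb0] at hb
    rw [← natDegree_lt_iff_degree_lt (mul_ne_zero hb0 hp), natDegree_mul hb0 hp]
    omega
  rw [fracChar_mk_mul, coeff_eq_zero_of_degree_lt hlt, AddChar.map_zero_eq_one]
  rw [degree_eq_natDegree hg.ne_zero]
  exact hlt.trans_le (by exact_mod_cast Nat.sub_le _ _)

theorem monicCharSum_of_lt (hg : g.Monic) {x : AdjoinRoot g} {n : ℕ}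
    (hn : n + (AdjoinRoot.modByMonicHom hg x).natDegree + 1 < g.natDegree) :
    monicCharSum hg x n = (Fintype.card F : ℂ) ^ n := by
  rw [monicCharSum, Finset.sum_congr rfl fun b _ => fracChar_eq_one hg (n := n + 1)
    (lt_of_le_of_lt (degree_add_le _ _) (max_lt ?_ ?_)) (by omega)]
  · simp [card_degreeLT]
  · rw [degree_X_pow]
    exact_mod_cast Nat.lt_succ_self n
  · exact (mem_degreeLT.1 b.2).trans (by exact_mod_cast Nat.lt_succ_self n)

theorem monicCharSum_of_eq (hg : g.Monic) {x : AdjoinRoot g} (hx : x ≠ 0) {n : ℕ}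
    (hn : n + (AdjoinRoot.modByMonicHom hg x).natDegree + 1 = g.natDegree) :
    monicCharSum hg x n = (Fintype.card F : ℂ) ^ n *
      eAddChar F (AdjoinRoot.modByMonicHom hg x).leadingCoeff := by
  have h (b : degreeLT F n) : fracChar hg (AdjoinRoot.mk g (X ^ n + (b : F[X])) * x) =
      eAddChar F (AdjoinRoot.modByMonicHom hg x).leadingCoeff := by
    rw [map_add, add_mul, AddChar.map_add_eq_mul,
      fracChar_eq_one hg (mem_degreeLT.1 b.2) (by omega), mul_one]
    simpa using fracChar_C_mul_X_pow_mul hg hx 1 hn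
  rw [monicCharSum, Finset.sum_congr rfl fun b _ => h b]
  simp [card_degreeLT]

end Residues

section MonicSums

variable {F : Type} [Field F]

/-- A monic polynomial of degree `n` is `X ^ n` plus a polynomial of degree less than `n`. -/
noncomputable def monicSigmaEquiv : (Σ n, degreeLT F n) ≃ {f : F[X] // f.Monic} :=
  (Equiv.sigmaCongrRight fun n => (monicEquivDegreeLT n).symm.trans
    (Equiv.subtypeSubtypeEquivSubtypeInter (Monic (R := F)) (fun p => p.natDegree = n)).symm).trans
    (Equiv.sigmaFiberEquiv fun f : {f : F[X] // f.Monic} => (f : F[X]).natDegree)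

theorem coe_monicSigmaEquiv (n : ℕ) (b : degreeLT F n) :
    (monicSigmaEquiv ⟨n, b⟩ : F[X]) = X ^ n + (b : F[X]) := rfl

theorem natDegree_monicSigmaEquiv (x : Σ n, degreeLT F n) :
    (monicSigmaEquiv x : F[X]).natDegree = x.1 :=
  ((monicEquivDegreeLT x.1).symm x.2).2.2

variable {g : F[X]}

theorem degree_modByMonicHom_lt_mul (hg : g.Monic) (p : {f : F[X] // f.Monic})
    (a : AdjoinRoot g) : (AdjoinRoot.modByMonicHom hg a).degree < (g * p).degree :=
  (degree_modByMonicHom_lt hg a).trans_le (degree_le_mul_left g p.2.ne_zero)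

/-- Division by `g`: a monic polynomial is either a reduced residue modulo `g`, or
`g p + r` with `p` monic and `r` a reduced residue. -/
noncomputable def monicDivEquiv (hg : g.Monic) :
    {a : AdjoinRoot g // (AdjoinRoot.modByMonicHom hg a).Monic} ⊕
      ({f : F[X] // f.Monic} × AdjoinRoot g) ≃ {f : F[X] // f.Monic} :=
  Equiv.ofBijective
    (Sum.elim (fun a => ⟨AdjoinRoot.modByMonicHom hg a.1, a.2⟩)
      (fun x => ⟨g * x.1 + AdjoinRoot.modByMonicHom hg x.2,
        (hg.mul x.1.2).add_of_left (degree_modByMonicHom_lt_mul hg x.1 x.2)⟩)) <| by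
    have key (p : F[X]) (a : AdjoinRoot g) :
        (g * p + AdjoinRoot.modByMonicHom hg a) /ₘ g = p ∧
          (g * p + AdjoinRoot.modByMonicHom hg a) %ₘ g = AdjoinRoot.modByMonicHom hg a :=
      div_modByMonic_unique p _ hg ⟨add_comm _ _, degree_modByMonicHom_lt hg a⟩
    have inj {p₁ p₂ : F[X]} {a₁ a₂ : AdjoinRoot g}
        (h : g * p₁ + AdjoinRoot.modByMonicHom hg a₁ =
          g * p₂ + AdjoinRoot.modByMonicHom hg a₂) : p₁ = p₂ ∧ a₁ = a₂ := by
      refine ⟨by rw [← (key p₁ a₁).1, h, (key p₂ a₂).1], ?_⟩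
      rw [← mk_modByMonicHom hg a₁, ← (key p₁ a₁).2, h, (key p₂ a₂).2, mk_modByMonicHom]
    constructor
    · rintro (⟨a, ha⟩ | ⟨p, a⟩) (⟨b, hb⟩ | ⟨r, b⟩) h
      · have := inj (p₁ := 0) (p₂ := 0) (a₁ := a) (a₂ := b) (by simpa using h)
        simp [this.2]
      · have := inj (p₁ := 0) (p₂ := r) (a₁ := a) (a₂ := b) (by simpa using h)
        exact absurd this.1.symm r.2.ne_zero
      · have := inj (p₁ := p) (p₂ := 0) (a₁ := a) (a₂ := b) (by simpa using h)
        exact absurd this.1 p.2.ne_zero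
      · have := inj (p₁ := p) (p₂ := r) (a₁ := a) (a₂ := b) (by simpa using h)
        rw [this.2, Subtype.ext this.1]
    · rintro ⟨f, hf⟩
      by_cases h : f.degree < g.degree
      · have hfg : AdjoinRoot.modByMonicHom hg (AdjoinRoot.mk g f) = f := by
          rw [AdjoinRoot.modByMonicHom_mk, (modByMonic_eq_self_iff hg).2 h]
        exact ⟨Sum.inl ⟨AdjoinRoot.mk g f, by rwa [hfg]⟩, Subtype.ext hfg⟩
      · refine ⟨Sum.inr ⟨⟨f /ₘ g, ?_⟩, AdjoinRoot.mk g f⟩, Subtype.ext ?_⟩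
        · rw [Monic, leadingCoeff_divByMonic_of_monic hg (not_lt.1 h), hf]
        · simp only [Sum.elim_inr, AdjoinRoot.modByMonicHom_mk]
          rw [add_comm, modByMonic_add_div]

theorem coe_monicDivEquiv_inl (hg : g.Monic)
    (a : {a : AdjoinRoot g // (AdjoinRoot.modByMonicHom hg a).Monic}) :
    (monicDivEquiv hg (Sum.inl a) : F[X]) = AdjoinRoot.modByMonicHom hg a.1 := rfl

theorem coe_monicDivEquiv_inr (hg : g.Monic) (x : {f : F[X] // f.Monic} × AdjoinRoot g) :
    (monicDivEquiv hg (Sum.inr x) : F[X]) = g * x.1 + AdjoinRoot.modByMonicHom hg x.2 := rfl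

variable [Fintype F]

theorem summable_norm_pow_natDegree {u : ℂ} (hu : ‖u‖ < 1 / Fintype.card F) :
    Summable fun f : {f : F[X] // f.Monic} => ‖u‖ ^ (f : F[X]).natDegree := by
  rw [← monicSigmaEquiv.summable_iff]
  simp only [Function.comp_def, natDegree_monicSigmaEquiv]
  refine (summable_sigma_of_nonneg fun _ => by positivity).2 ⟨fun n => Summable.of_finite, ?_⟩
  simp only [tsum_fintype, Finset.sum_const, Finset.card_univ, card_degreeLT, nsmul_eq_mul,
    Nat.cast_pow, ← mul_pow]
  refine summable_geometric_of_lt_one (by positivity) ?_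
  rwa [lt_div_iff₀' (by exact_mod_cast Fintype.card_pos)] at hu

theorem summable_norm_pow_natDegree_mul {u : ℂ} (hu : ‖u‖ < 1 / Fintype.card F)
    {h : {f : F[X] // f.Monic} → ℂ} {B : ℝ} (hh : ∀ f, ‖h f‖ ≤ B) :
    Summable fun f : {f : F[X] // f.Monic} => ‖u ^ (f : F[X]).natDegree * h f‖ := by
  refine Summable.of_nonneg_of_le (fun _ => norm_nonneg _) (fun f => ?_)
    ((summable_norm_pow_natDegree hu).mul_right B)
  rw [norm_mul, norm_pow]
  gcongr
  exact hh f

theorem hasSum_monic_of_hasSum_degree {u : ℂ} (hu : ‖u‖ < 1 / Fintype.card F)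
    {h : F[X] → ℂ} {B : ℝ} (hh : ∀ f, ‖h f‖ ≤ B) {s : ℂ}
    (hs : HasSum (fun n => u ^ n * ∑ b : degreeLT F n, h (X ^ n + (b : F[X]))) s) :
    HasSum (fun f : {f : F[X] // f.Monic} => u ^ (f : F[X]).natDegree * h f) s := by
  have hsum := (summable_norm_pow_natDegree_mul hu (h := fun f => h f) fun f => hh f).of_norm
  have h1 := monicSigmaEquiv.hasSum_iff.2 hsum.hasSum
  have h2 := h1.sigma fun n => hasSum_fintype _
  simp only [Function.comp_apply, natDegree_monicSigmaEquiv] at h2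
  simp only [coe_monicSigmaEquiv, ← Finset.mul_sum] at h2
  rw [hs.unique h2]
  exact hsum.hasSum

theorem hasSum_pow_natDegree {u : ℂ} (hu : ‖u‖ < 1 / Fintype.card F) :
    HasSum (fun f : {f : F[X] // f.Monic} => u ^ (f : F[X]).natDegree)
      (1 - Fintype.card F * u)⁻¹ := by
  have hq : ‖(Fintype.card F : ℂ) * u‖ < 1 := by
    rw [norm_mul, Complex.norm_natCast]
    rwa [lt_div_iff₀' (by exact_mod_cast Fintype.card_pos)] at hu
  have h := hasSum_monic_of_hasSum_degree hu (h := fun _ : F[X] => (1 : ℂ)) (B := 1)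
    (fun _ => by simp) (s := (1 - Fintype.card F * u)⁻¹) ?_
  · simpa using h
  · refine (hasSum_geometric_of_norm_lt_one hq).congr_fun fun n => ?_
    simp [card_degreeLT, mul_pow, mul_comm]

/-- The rational continuation of `∑ u ^ deg f` over the monic `f` in the residue class `a`. -/
noncomputable def resWeight (hg : g.Monic) (u : ℂ) (a : AdjoinRoot g) : ℂ :=
  (if (AdjoinRoot.modByMonicHom hg a).Monic then
    u ^ (AdjoinRoot.modByMonicHom hg a).natDegree else 0) +
    u ^ g.natDegree / (1 - Fintype.card F * u)

variable [Fintype (AdjoinRoot g)]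

theorem hasSum_resWeight (hg : g.Monic) {u : ℂ} (hu : ‖u‖ < 1 / Fintype.card F)
    (h : AdjoinRoot g → ℂ) :
    HasSum (fun f : {f : F[X] // f.Monic} => u ^ (f : F[X]).natDegree * h (AdjoinRoot.mk g f))
      (∑ a, resWeight hg u a * h a) := by
  have hmk (p : F[X]) (a : AdjoinRoot g) :
      AdjoinRoot.mk g (g * p + AdjoinRoot.modByMonicHom hg a) = a := by
    rw [map_add, map_mul, AdjoinRoot.mk_self, zero_mul, zero_add, mk_modByMonicHom]
  have hdeg (p : {f : F[X] // f.Monic}) (a : AdjoinRoot g) :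
      (g * p + AdjoinRoot.modByMonicHom hg a).natDegree = g.natDegree + (p : F[X]).natDegree := by
    rw [natDegree_add_eq_left_of_degree_lt (degree_modByMonicHom_lt_mul hg p a),
      hg.natDegree_mul p.2]
  set T : {f : F[X] // f.Monic} → ℂ :=
    fun f => u ^ (f : F[X]).natDegree * h (AdjoinRoot.mk g f) with hT
  have hsmall : HasSum (T ∘ monicDivEquiv hg ∘ Sum.inl) (∑ a,
      (if (AdjoinRoot.modByMonicHom hg a).Monic then
        u ^ (AdjoinRoot.modByMonicHom hg a).natDegree else 0) * h a) := by
    convert hasSum_fintype (T ∘ monicDivEquiv hg ∘ Sum.inl) using 1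
    simp only [hT, Function.comp_apply, coe_monicDivEquiv_inl, mk_modByMonicHom, ite_mul, zero_mul]
    rw [← Finset.sum_filter]
    exact Finset.sum_subtype _ (by simp) _
  have hlarge : HasSum (T ∘ monicDivEquiv hg ∘ Sum.inr)
      (u ^ g.natDegree * ((1 - Fintype.card F * u)⁻¹ * ∑ a, h a)) := by
    have hn : Summable fun f : {f : F[X] // f.Monic} => ‖u ^ (f : F[X]).natDegree‖ := by
      simpa only [norm_pow] using summable_norm_pow_natDegree hu
    have hh : Summable fun a => ‖h a‖ := Summable.of_finite
    have h1 := summable_mul_of_summable_norm hn hh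
    have h2 := (hasSum_pow_natDegree hu).mul (hasSum_fintype h) h1
    refine (h2.mul_left (u ^ g.natDegree)).congr_fun fun x => ?_
    simp only [hT, Function.comp_apply, coe_monicDivEquiv_inr, hmk, hdeg, pow_add, mul_assoc]
  rw [← (monicDivEquiv hg).hasSum_iff]
  have hs := HasSum.sum (f := T ∘ monicDivEquiv hg) hsmall hlarge
  have he : (∑ a, resWeight hg u a * h a) = (∑ a,
      (if (AdjoinRoot.modByMonicHom hg a).Monic then
        u ^ (AdjoinRoot.modByMonicHom hg a).natDegree else 0) * h a) +
      u ^ g.natDegree * ((1 - Fintype.card F * u)⁻¹ * ∑ a, h a) := by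
    simp only [resWeight, add_mul, Finset.sum_add_distrib, ← Finset.mul_sum]
    ring
  rw [he]
  exact hs

end MonicSums

section FiniteEstermann

variable {F : Type} [Field F] {g : F[X]}

theorem card_fiber_mul (f : {f : F[X] // f.Monic}) :
    Nat.card ↑((fun x : {f : F[X] // f.Monic} × {f : F[X] // f.Monic} =>
      (⟨x.1 * x.2, x.1.2.mul x.2.2⟩ : {f : F[X] // f.Monic})) ⁻¹' {f}) = dCount (f : F[X]) := by
  rw [dCount, ← Nat.card_coe_set_eq]
  refine Nat.card_congr (Equiv.ofBijective
    (fun x => ⟨x.1.1, x.1.1.2, x.1.2, (congrArg Subtype.val x.2).symm⟩) ⟨?_, ?_⟩)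
  · rintro ⟨⟨a, b⟩, h⟩ ⟨⟨a', b'⟩, h'⟩ heq
    have ha' : (a : F[X]) = a' := by simpa only [Subtype.mk.injEq] using heq
    have ha : a = a' := Subtype.ext ha'
    subst ha
    have hb : (a * b : F[X]) = a * b' :=
      (congrArg Subtype.val h).trans (congrArg Subtype.val h').symm
    have hb' : b = b' := Subtype.ext (mul_left_cancel₀ a.2.ne_zero hb)
    subst hb'
    rfl
  · rintro ⟨a, ha, b, hb⟩
    exact ⟨⟨⟨⟨a, ha⟩, ⟨b, ha.of_mul_monic_left (hb ▸ f.2)⟩⟩, Subtype.ext hb.symm⟩, rfl⟩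

variable [Fintype F]

theorem hasSum_monicCharSum (hg : g.Monic) {u : ℂ} (hu : ‖u‖ < 1 / Fintype.card F)
    {x : AdjoinRoot g} {s : ℂ} (hs : HasSum (fun n => u ^ n * monicCharSum hg x n) s) :
    HasSum (fun f : {f : F[X] // f.Monic} =>
      u ^ (f : F[X]).natDegree * fracChar hg (AdjoinRoot.mk g f * x)) s :=
  hasSum_monic_of_hasSum_degree hu (h := fun f => fracChar hg (AdjoinRoot.mk g f * x))
    (fun _ => (norm_fracChar hg _).le) hs

theorem resWeight_zero (hg : g.Monic) (u : ℂ) :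
    resWeight hg u 0 = u ^ g.natDegree / (1 - Fintype.card F * u) := by
  simp [resWeight, Monic]

theorem resWeight_inv_smul (hg : g.Monic) (u : ℂ) {x : AdjoinRoot g} (hx : x ≠ 0) (α : Fˣ) :
    resWeight hg u (((α⁻¹ : Fˣ) : F) • x) =
      (if α = Units.mk0 _ (leadingCoeff_ne_zero.2 (mt (modByMonicHom_eq_zero_iff hg).1 hx)) then
        u ^ (AdjoinRoot.modByMonicHom hg x).natDegree else 0) +
      u ^ g.natDegree / (1 - Fintype.card F * u) := by
  have hα : ((α⁻¹ : Fˣ) : F) ≠ 0 := Units.ne_zero _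
  rw [resWeight, map_smul, natDegree_smul _ hα]
  congr 2
  rw [Monic, leadingCoeff_smul_of_smul_regular _ (IsSMulRegular.of_ne_zero hα), smul_eq_mul,
    Units.val_inv_eq_inv_val, inv_mul_eq_one₀ α.ne_zero, Units.ext_iff, Units.val_mk0]

theorem sum_eAddChar_sub (t : ℂ) :
    ∑ α : Fˣ, (eAddChar F (α : F) - t) = -1 - ((Fintype.card F : ℂ) - 1) * t := by
  rw [Finset.sum_sub_distrib, sum_units_eAddChar, Finset.sum_const, Finset.card_univ,
    Fintype.card_units, nsmul_eq_mul, Nat.cast_sub Fintype.card_pos, Nat.cast_one]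

theorem card_mul_ne_one {u : ℂ} (hu : ‖u‖ < 1 / Fintype.card F) :
    (Fintype.card F : ℂ) * u ≠ 1 := by
  intro h
  rw [lt_div_iff₀' (by exact_mod_cast Fintype.card_pos)] at hu
  have := congrArg norm h
  rw [norm_mul, Complex.norm_natCast, norm_one] at this
  linarith

theorem ne_one_of_norm_lt {u : ℂ} (hu : ‖u‖ < 1 / Fintype.card F) : u ≠ 1 := by
  rintro rfl
  rw [norm_one, lt_div_iff₀' (by exact_mod_cast Fintype.card_pos), mul_one] at hu
  have : (1 : ℝ) ≤ Fintype.card F := by exact_mod_cast Fintype.card_pos (α := F)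
  linarith

variable [Fintype (AdjoinRoot g)]

/-- The functional equation of `resWeight` under the Fourier transform modulo `g`. -/
theorem fourier_resWeight (hg : g.Monic) (hN : 1 ≤ g.natDegree) {u : ℂ} (hu0 : u ≠ 0)
    (hu : ‖u‖ < 1 / Fintype.card F) (x : AdjoinRoot g) :
    ∑ a, resWeight hg u a * fracChar hg (a * x) =
      (Fintype.card F * u) ^ (g.natDegree - 1) *
        ∑ α : Fˣ, (eAddChar F (α : F) - 1 / (1 - Fintype.card F * u)) *
          resWeight hg (1 / (Fintype.card F * u)) (((α⁻¹ : Fˣ) : F) • x) := by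
  have hL := hasSum_resWeight hg hu (fun a => fracChar hg (a * x))
  have hq0 : (Fintype.card F : ℂ) ≠ 0 := by exact_mod_cast Fintype.card_ne_zero
  have hqu : (1 : ℂ) - Fintype.card F * u ≠ 0 := sub_ne_zero.2 (card_mul_ne_one hu).symm
  have hu1 : u - 1 ≠ 0 := sub_ne_zero.2 (ne_one_of_norm_lt hu)
  have hconst : (Fintype.card F * u) ^ (g.natDegree - 1) *
      ((-1 - ((Fintype.card F : ℂ) - 1) * (1 / (1 - Fintype.card F * u))) *
        ((1 / (Fintype.card F * u)) ^ g.natDegree /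
          (1 - Fintype.card F * (1 / (Fintype.card F * u))))) = 1 / (1 - Fintype.card F * u) := by
    obtain ⟨N, hN'⟩ : ∃ N, g.natDegree = N + 1 := ⟨_, (Nat.sub_add_cancel hN).symm⟩
    rw [hN', Nat.add_sub_cancel, pow_succ,
      show (1 : ℂ) - Fintype.card F * (1 / (Fintype.card F * u)) = (u - 1) / u by field_simp,
      one_div_pow]
    field_simp
    ring
  by_cases hx : x = 0
  · subst hx
    simp only [smul_zero, resWeight_zero]
    rw [← Finset.sum_mul, sum_eAddChar_sub, hconst, one_div, ← (hasSum_pow_natDegree hu).unique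
      (hL.congr_fun fun f => by simp [AddChar.map_zero_eq_one])]
  · have hd := natDegree_modByMonicHom_lt hg hx
    obtain ⟨k, hk⟩ : ∃ k, k + (AdjoinRoot.modByMonicHom hg x).natDegree + 1 = g.natDegree :=
      ⟨g.natDegree - 1 - (AdjoinRoot.modByMonicHom hg x).natDegree, by omega⟩
    have hR : HasSum (fun n => u ^ n * monicCharSum hg x n)
        (∑ n ∈ Finset.range (k + 1), u ^ n * monicCharSum hg x n) := by
      refine hasSum_sum_of_ne_finset_zero fun n hn => ?_
      rw [Finset.mem_range, not_lt] at hn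
      rw [monicCharSum_eq_zero hg hx (by omega), mul_zero]
    rw [hL.unique (hasSum_monicCharSum hg hu hR), Finset.sum_range_succ,
      monicCharSum_of_eq hg hx hk, Finset.sum_congr rfl fun n hn => by
        rw [monicCharSum_of_lt hg (x := x) (n := n)
          (by rw [Finset.mem_range] at hn; omega), ← mul_pow, mul_comm u],
      geom_sum_eq (card_mul_ne_one hu)]
    simp only [resWeight_inv_smul hg _ hx, mul_add, Finset.sum_add_distrib, mul_ite, mul_zero,
      Finset.sum_ite_eq', Finset.mem_univ, if_true, Units.val_mk0]
    rw [← Finset.sum_mul, sum_eAddChar_sub, hconst, ← hk,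
      Nat.add_sub_cancel]
    have hqu' : (Fintype.card F : ℂ) * u - 1 ≠ 0 := sub_ne_zero.2 (card_mul_ne_one hu)
    have e : (Fintype.card F * u) ^ (k + (AdjoinRoot.modByMonicHom hg x).natDegree) *
        ((eAddChar F (AdjoinRoot.modByMonicHom hg x).leadingCoeff - 1 / (1 - Fintype.card F * u)) *
          (1 / (Fintype.card F * u)) ^ (AdjoinRoot.modByMonicHom hg x).natDegree) =
        (Fintype.card F * u) ^ k *
          (eAddChar F (AdjoinRoot.modByMonicHom hg x).leadingCoeff -
            1 / (1 - Fintype.card F * u)) := by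
      rw [pow_add, one_div_pow]
      field_simp
    rw [e, show (1 : ℂ) - Fintype.card F * u = -(Fintype.card F * u - 1) by ring, mul_pow]
    field_simp
    ring

/-- The rational continuation of the Estermann function `D₂(u; c / g)`. -/
noncomputable def estermannRat (hg : g.Monic) (u : ℂ) (c : AdjoinRoot g) : ℂ :=
  ∑ a, resWeight hg u a * ∑ b, resWeight hg u b * fracChar hg (c * (a * b))

theorem hasSum_estermannRat (hg : g.Monic) {u : ℂ} (hu : ‖u‖ < 1 / Fintype.card F) (c : F[X]) :
    HasSum (fun f : {f : F[X] // f.Monic} =>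
      (dCount (f : F[X]) : ℂ) * eFrac (c * (f : F[X])) g * u ^ (f : F[X]).natDegree)
      (estermannRat hg u (AdjoinRoot.mk g c)) := by
  set T : {f : F[X] // f.Monic} × {f : F[X] // f.Monic} → ℂ := fun x =>
    u ^ (x.1 : F[X]).natDegree * (u ^ (x.2 : F[X]).natDegree *
      fracChar hg (AdjoinRoot.mk g c * (AdjoinRoot.mk g x.1 * AdjoinRoot.mk g x.2))) with hT
  have hT_sum : Summable T := by
    have hn := summable_norm_pow_natDegree hu
    have h2 := hn.mul_of_nonneg hn (fun _ => pow_nonneg (norm_nonneg u) _)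
      (fun _ => pow_nonneg (norm_nonneg u) _)
    refine h2.of_norm_bounded fun x => ?_
    simp only [hT, norm_mul, norm_pow, norm_fracChar, mul_one, le_refl]
  have hT_has : HasSum T (estermannRat hg u (AdjoinRoot.mk g c)) := by
    have h0 (a : {f : F[X] // f.Monic}) : HasSum (fun b => T (a, b))
        (u ^ (a : F[X]).natDegree * ∑ b, resWeight hg u b *
          fracChar hg (AdjoinRoot.mk g c * (AdjoinRoot.mk g a * b))) := by
      have h := hasSum_resWeight hg hu fun b =>
        fracChar hg (AdjoinRoot.mk g c * (AdjoinRoot.mk g a * b))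
      exact h.mul_left (u ^ (a : F[X]).natDegree)
    have h1 := hT_sum.hasSum.prod_fiberwise h0
    have h2 := hasSum_resWeight hg hu fun a => ∑ b, resWeight hg u b *
        fracChar hg (AdjoinRoot.mk g c * (a * b))
    rw [estermannRat, h2.unique h1]
    exact hT_sum.hasSum
  refine (hT_has.tsum_fiberwise fun x => (⟨x.1 * x.2, x.1.2.mul x.2.2⟩ :
    {f : F[X] // f.Monic})).congr_fun fun f => ?_
  have hconst (x : ↑((fun x : {f : F[X] // f.Monic} × {f : F[X] // f.Monic} =>
      (⟨x.1 * x.2, x.1.2.mul x.2.2⟩ : {f : F[X] // f.Monic})) ⁻¹' {f})) :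
      T x = u ^ (f : F[X]).natDegree * eFrac (c * (f : F[X])) g := by
    obtain ⟨⟨a, b⟩, h⟩ := x
    have hf : (a * b : F[X]) = f := congrArg Subtype.val h
    simp only [hT]
    rw [← mul_assoc, ← pow_add, ← a.2.natDegree_mul b.2, ← map_mul, ← map_mul, hf, fracChar_mk]
  rw [tsum_congr hconst, tsum_const, card_fiber_mul, nsmul_eq_mul]
  ring

end FiniteEstermann

section FunctionalEquation

variable {F : Type} [Field F] [Fintype F] {g : F[X]}

theorem sum_units_eAddChar_mul (β : Fˣ) : ∑ γ : Fˣ, eAddChar F ((β : F) * γ) = -1 := by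
  rw [← sum_units_eAddChar F]
  exact Equiv.sum_comp (Equiv.mulLeft β) fun γ : Fˣ => eAddChar F (γ : F)

theorem sum_units_eAddChar_mul_inv (β : Fˣ) :
    ∑ γ : Fˣ, eAddChar F ((β : F) * ((γ⁻¹ : Fˣ) : F)) = -1 := by
  rw [← sum_units_eAddChar_mul β, ← Equiv.sum_comp (Equiv.inv Fˣ)]
  simp only [Equiv.inv_apply, inv_inv]

theorem sum_units_eAddChar_sub_mul_sub (β : Fˣ) (t : ℂ) :
    ∑ γ : Fˣ, (eAddChar F ((β * γ⁻¹ : Fˣ) : F) - t) * (eAddChar F ((-γ : Fˣ) : F) - t) =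
      Kl2 (-1 : F) (β : F) + 2 * t + ((Fintype.card F : ℂ) - 1) * t ^ 2 := by
  have hneg := sum_units_eAddChar_mul (F := F) (-1)
  have hinv := sum_units_eAddChar_mul_inv β
  have hKl : Kl2 (-1 : F) (β : F) =
      ∑ γ : Fˣ, eAddChar F ((β : F) * ((γ⁻¹ : Fˣ) : F)) * eAddChar F (((-1 : Fˣ) : F) * γ) := by
    refine Finset.sum_congr rfl fun γ _ => ?_
    rw [← AddChar.map_add_eq_mul, eAddChar_apply, add_comm, Units.val_neg, Units.val_one]
  have hcard : ∑ _γ : Fˣ, t ^ 2 = ((Fintype.card F : ℂ) - 1) * t ^ 2 := by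
    rw [Finset.sum_const, Finset.card_univ, Fintype.card_units, nsmul_eq_mul,
      Nat.cast_sub Fintype.card_pos, Nat.cast_one]
  have hsplit (γ : Fˣ) :
      (eAddChar F ((β * γ⁻¹ : Fˣ) : F) - t) * (eAddChar F ((-γ : Fˣ) : F) - t) =
        eAddChar F ((β : F) * ((γ⁻¹ : Fˣ) : F)) * eAddChar F (((-1 : Fˣ) : F) * γ) -
          t * eAddChar F ((β : F) * ((γ⁻¹ : Fˣ) : F)) - t * eAddChar F (((-1 : Fˣ) : F) * γ) +
          t ^ 2 := by
    rw [← Units.val_mul, ← Units.val_mul, neg_one_mul]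
    ring
  simp only [hsplit, Finset.sum_add_distrib, Finset.sum_sub_distrib, ← Finset.mul_sum]
  rw [hneg, hinv, ← hKl, hcard]
  ring

/-- Substituting `(α, β) = (β γ⁻¹, -γ)` in a double sum over units. -/
theorem sum_units_sum_units (f : Fˣ → Fˣ → ℂ) :
    ∑ α, ∑ β, f α β = ∑ β : Fˣ, ∑ γ : Fˣ, f (β * γ⁻¹) (-γ) := by
  rw [Finset.sum_comm, Finset.sum_comm (s := (Finset.univ : Finset Fˣ)) (t := Finset.univ)
    (f := fun β γ => f (β * γ⁻¹) (-γ)), ← Equiv.sum_comp (Equiv.neg Fˣ)]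
  refine Finset.sum_congr rfl fun γ _ => ?_
  rw [← Equiv.sum_comp (Equiv.mulRight γ⁻¹)]
  simp only [Equiv.coe_mulRight, Equiv.neg_apply]

variable [Fintype (AdjoinRoot g)]

theorem card_adjoinRoot (hg : g.Monic) :
    Fintype.card (AdjoinRoot g) = Fintype.card F ^ g.natDegree := by
  rw [Module.card_eq_pow_finrank (K := F), (AdjoinRoot.powerBasis' hg).finrank,
    AdjoinRoot.powerBasis'_dim]

theorem fourier_inversion (hg : g.Monic) (f : AdjoinRoot g → ℂ) (x : AdjoinRoot g) :
    ∑ z, (∑ a, f a * fracChar hg (a * z)) * fracChar hg (-(z * x)) =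
      (Fintype.card F : ℂ) ^ g.natDegree * f x := by
  have h (a : AdjoinRoot g) : ∑ z, fracChar hg (z * (a - x)) =
      if a = x then (Fintype.card F : ℂ) ^ g.natDegree else 0 := by
    rw [AddChar.sum_mulShift _ (fracChar_isPrimitive hg)]
    simp [sub_eq_zero, card_adjoinRoot hg]
  simp only [Finset.sum_mul]
  rw [Finset.sum_comm]
  have h2 (a : AdjoinRoot g) : ∑ z, f a * fracChar hg (a * z) * fracChar hg (-(z * x)) =
      f a * if a = x then (Fintype.card F : ℂ) ^ g.natDegree else 0 := by
    rw [← h, Finset.mul_sum]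
    refine Finset.sum_congr rfl fun z _ => ?_
    rw [mul_assoc, ← AddChar.map_add_eq_mul]
    congr 2
    ring
  simp only [h2, mul_ite, mul_zero, Finset.sum_ite_eq', Finset.mem_univ, if_true]
  ring

theorem resWeight_eq_fourier (hg : g.Monic) (hN : 1 ≤ g.natDegree) {u : ℂ} (hu0 : u ≠ 0)
    (hu : ‖u‖ < 1 / Fintype.card F) (x : AdjoinRoot g) :
    (Fintype.card F : ℂ) ^ g.natDegree * resWeight hg u x =
      (Fintype.card F * u) ^ (g.natDegree - 1) *
        ∑ β : Fˣ, (eAddChar F (β : F) - 1 / (1 - Fintype.card F * u)) *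
          ∑ z, resWeight hg (1 / (Fintype.card F * u)) z *
            fracChar hg (-(((β : F) • z) * x)) := by
  rw [← fourier_inversion hg]
  simp only [fourier_resWeight hg hN hu0 hu, mul_assoc, ← Finset.mul_sum, Finset.sum_mul]
  congr 1
  rw [Finset.sum_comm]
  refine Finset.sum_congr rfl fun β _ => ?_
  rw [← Finset.mul_sum, ← Equiv.sum_comp (MulAction.toPerm β)]
  congr 1
  refine Finset.sum_congr rfl fun z _ => ?_
  simp only [MulAction.toPerm_apply, Units.smul_def, smul_smul, Units.inv_mul, one_smul]

theorem estermannRat_eq_sum_sum (hg : g.Monic) (hN : 1 ≤ g.natDegree) {u : ℂ} (hu0 : u ≠ 0)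
    (hu : ‖u‖ < 1 / Fintype.card F) {c c' : AdjoinRoot g} (hc : c * c' = 1) :
    (Fintype.card F : ℂ) ^ g.natDegree * estermannRat hg u c =
      (Fintype.card F * u) ^ (2 * (g.natDegree - 1)) *
        ∑ α : Fˣ, ∑ β : Fˣ, (eAddChar F (α : F) - 1 / (1 - Fintype.card F * u)) *
          (eAddChar F (β : F) - 1 / (1 - Fintype.card F * u)) *
          estermannRat hg (1 / (Fintype.card F * u)) (((-(α * β) : Fˣ) : F) • c') := by
  set w : Fˣ → ℂ := fun α => eAddChar F (α : F) - 1 / (1 - Fintype.card F * u) with hw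
  set v : ℂ := 1 / (Fintype.card F * u) with hv
  set K : ℂ := (Fintype.card F * u) ^ (g.natDegree - 1) with hK
  have h1 : estermannRat hg u c = K * ∑ α, w α * ∑ y, resWeight hg v y *
      resWeight hg u ((α : F) • (c' * y)) := by
    have h (a : AdjoinRoot g) : ∑ b, resWeight hg u b * fracChar hg (c * (a * b)) =
        K * ∑ α, w α * resWeight hg v (((α⁻¹ : Fˣ) : F) • (c * a)) := by
      rw [← fourier_resWeight hg hN hu0 hu]
      refine Finset.sum_congr rfl fun b _ => ?_
      congr 2
      ring
    simp only [estermannRat, h, Finset.mul_sum]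
    rw [Finset.sum_comm]
    refine Finset.sum_congr rfl fun α _ => ?_
    have hc' : c' * c = 1 := by rw [mul_comm, hc]
    let e : AdjoinRoot g ≃ AdjoinRoot g :=
      { toFun := fun y => (α : F) • (c' * y)
        invFun := fun a => ((α⁻¹ : Fˣ) : F) • (c * a)
        left_inv := fun y => by
          simp only [mul_smul_comm, smul_smul, Units.inv_mul, one_smul, ← mul_assoc, hc, one_mul]
        right_inv := fun a => by
          simp only [mul_smul_comm, smul_smul, Units.mul_inv, one_smul, ← mul_assoc, hc',
            one_mul] }
    rw [← Equiv.sum_comp e]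
    refine Finset.sum_congr rfl fun y _ => ?_
    have he : ((α⁻¹ : Fˣ) : F) • (c * e y) = y := e.left_inv y
    rw [he]
    change resWeight hg u ((α : F) • (c' * y)) * _ = _
    ring
  have h2 (α : Fˣ) (y : AdjoinRoot g) := resWeight_eq_fourier hg hN hu0 hu ((α : F) • (c' * y))
  rw [h1, mul_left_comm, mul_comm 2, pow_mul, ← hK, pow_two, mul_assoc]
  congr 1
  simp only [Finset.mul_sum] at h2 ⊢
  refine Finset.sum_congr rfl fun α _ => ?_
  have h3 (y : AdjoinRoot g) : (Fintype.card F : ℂ) ^ g.natDegree *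
      (w α * (resWeight hg v y * resWeight hg u ((α : F) • (c' * y)))) =
      ∑ β, ∑ z, K * (w α * w β * (resWeight hg v y * (resWeight hg v z *
        fracChar hg (((-(α * β) : Fˣ) : F) • c' * (y * z))))) := by
    have := h2 α y
    calc _ = w α * resWeight hg v y * ((Fintype.card F : ℂ) ^ g.natDegree *
        resWeight hg u ((α : F) • (c' * y))) := by ring
      _ = _ := by
        rw [this, Finset.mul_sum]
        refine Finset.sum_congr rfl fun β _ => ?_
        rw [Finset.mul_sum]
        refine Finset.sum_congr rfl fun z _ => ?_
        have hz : -(((β : F) • z) * ((α : F) • (c' * y))) =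
            ((-(α * β) : Fˣ) : F) • c' * (y * z) := by
          simp only [Algebra.smul_def, Units.val_neg, Units.val_mul, map_neg, map_mul]
          ring
        rw [hz]
        ring
  simp only [h3]
  rw [Finset.sum_comm]
  refine Finset.sum_congr rfl fun β _ => ?_
  simp only [estermannRat, Finset.mul_sum, hw]

theorem estermannRat_functional_equation (hg : g.Monic) (hN : 1 ≤ g.natDegree) {u : ℂ}
    (hu0 : u ≠ 0) (hu : ‖u‖ < 1 / Fintype.card F) {c c' : AdjoinRoot g} (hc : c * c' = 1) :
    estermannRat hg u c = (Fintype.card F * u ^ 2) ^ (g.natDegree - 1) *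
      ∑ β : Fˣ, (Kl2 (-1 : F) (β : F) / Fintype.card F +
        (1 + Fintype.card F - 2 * Fintype.card F * u) /
          (Fintype.card F * (1 - Fintype.card F * u) ^ 2)) *
        estermannRat hg (1 / (Fintype.card F * u)) ((β : F) • c') := by
  have hq0 : (Fintype.card F : ℂ) ≠ 0 := by exact_mod_cast Fintype.card_ne_zero
  have hqu : (1 : ℂ) - Fintype.card F * u ≠ 0 := sub_ne_zero.2 (card_mul_ne_one hu).symm
  have h := estermannRat_eq_sum_sum hg hN hu0 hu hc
  rw [sum_units_sum_units] at h
  have hprod (β γ : Fˣ) : -(β * γ⁻¹ * -γ) = β := by simp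
  simp only [hprod, ← Finset.sum_mul, sum_units_eAddChar_sub_mul_sub] at h
  obtain ⟨n, hn⟩ : ∃ n, g.natDegree = n + 1 := ⟨_, (Nat.sub_add_cancel hN).symm⟩
  rw [hn, Nat.add_sub_cancel] at h ⊢
  refine mul_left_cancel₀ (pow_ne_zero (n + 1) hq0) (h.trans ?_)
  have hpow : (Fintype.card F : ℂ) ^ (n + 1) * (Fintype.card F * u ^ 2) ^ n =
      (Fintype.card F * u) ^ (2 * n) * Fintype.card F := by ring
  rw [← mul_assoc, hpow, mul_assoc]
  congr 1
  rw [Finset.mul_sum]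
  refine Finset.sum_congr rfl fun β _ => ?_
  rw [← mul_assoc]
  congr 1
  field_simp
  ring

theorem exists_eval_eq_estermannRat_mul (hg : g.Monic) (c : AdjoinRoot g) :
    ∃ p : ℂ[X], ∀ u : ℂ, Fintype.card F * u ≠ 1 →
      estermannRat hg u c * (1 - Fintype.card F * u) ^ 2 = p.eval u := by
  let r : AdjoinRoot g → ℂ[X] := fun a =>
    (if (AdjoinRoot.modByMonicHom hg a).Monic then
      X ^ (AdjoinRoot.modByMonicHom hg a).natDegree else 0) * (1 - C (Fintype.card F : ℂ) * X) +
    X ^ g.natDegree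
  have hr {u : ℂ} (hu : Fintype.card F * u ≠ 1) (a : AdjoinRoot g) :
      resWeight hg u a * (1 - Fintype.card F * u) = (r a).eval u := by
    have hqu : (1 : ℂ) - Fintype.card F * u ≠ 0 := sub_ne_zero.2 hu.symm
    simp only [resWeight, r]
    split_ifs <;> simp <;> field_simp
  refine ⟨∑ a, r a * ∑ b, r b * C (fracChar hg (c * (a * b))), fun u hu => ?_⟩
  simp only [estermannRat, eval_finsetSum, eval_mul, eval_C, ← hr hu, Finset.sum_mul,
    Finset.mul_sum]
  refine Finset.sum_congr rfl fun a _ => Finset.sum_congr rfl fun b _ => ?_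
  ring

end FunctionalEquation

theorem IsRatCont.eq_of_eval_eq {F : Type} [Field F] [Fintype F] {a : F[X] → ℂ} {φ ψ : ℂ → ℂ}
    (hφ : IsRatCont a φ) {d p : ℂ[X]} (hψ : ∀ u, d.eval u ≠ 0 → ψ u * d.eval u = p.eval u)
    (hd : ∀ u : ℂ, ‖u‖ < 1 / Fintype.card F → d.eval u ≠ 0)
    (h : ∀ u : ℂ, ‖u‖ < 1 / Fintype.card F → φ u = ψ u) {v : ℂ} (hv : d.eval v ≠ 0) :
    φ v = ψ v := by
  obtain ⟨⟨P, Q, hPQ, hQ, hφQ⟩, -⟩ := hφ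
  have hball : (Metric.ball (0 : ℂ) (1 / Fintype.card F)).Infinite :=
    infinite_of_mem_nhds 0 (Metric.ball_mem_nhds _ (by
      have : (0 : ℝ) < Fintype.card F := by exact_mod_cast Fintype.card_pos
      positivity))
  have hroots : {z : ℂ | Q.eval z = 0}.Finite := by
    refine (Q.roots.toFinset.finite_toSet).subset fun z hz => ?_
    simpa [hQ] using hz
  have hpoly : P * d = p * Q := by
    refine eq_of_infinite_eval_eq _ _ ((hball.sdiff hroots).mono ?_)
    rintro z ⟨hz, hzQ⟩
    rw [mem_ball_zero_iff] at hz
    have hzQ' : Q.eval z ≠ 0 := hzQ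
    have h1 := hφQ z hzQ'
    rw [h z hz, eq_div_iff hzQ'] at h1
    rw [Set.mem_ofPred_eq, eval_mul, eval_mul, ← hψ z (hd z hz), ← h1]
    ring
  have hv' := congrArg (eval v) hpoly
  rw [eval_mul, eval_mul] at hv'
  have hQv : Q.eval v ≠ 0 := by
    intro h0
    rw [h0, mul_zero] at hv'
    have hPv : P.eval v = 0 := (mul_eq_zero.1 hv').resolve_right hv
    obtain ⟨A, B, hAB⟩ := hPQ
    simpa [h0, hPv] using congrArg (eval v) hAB
  rw [hφQ v hQv, div_eq_iff hQv]
  refine mul_right_cancel₀ hv ?_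
  rw [hv', ← hψ v hv]
  ring

/-- **Functional equation of the Estermann function over `𝔽_q[T]`:**
for `deg g ≥ 1`, `gcd(c,g) = 1` and `0 < |u| < 1/q`,
`D_2(u;c/g) = (qu²)^{deg g - 1} Σ_{λ ∈ F^×} A_λ(u)·D_2(1/(qu); λc̄/g)` with
`A_λ(u) = Kl₂(-1,λ)/q + (1 + q - 2qu)/(q(1-qu)²)`, and `D_2` on the right evaluated
via its rational continuation. -/
theorem estermannD2_functional_equation
    (F : Type) [Field F] [Fintype F] (q : ℕ) (hq : q = Fintype.card F)
    (g : Polynomial F) (hg : g.Monic) (hgdeg : 1 ≤ g.natDegree)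
    (c cbar : Polynomial F) (hcop : IsCoprime c g) (hcbar : g ∣ c * cbar - 1)
    (φ : Fˣ → ℂ → ℂ)
    (hφ : ∀ lam : Fˣ,
      IsRatCont
        (fun f => (dCount f : ℂ) * eFrac (Polynomial.C (lam : F) * cbar * f) g)
        (φ lam))
    (u : ℂ) (hu0 : 0 < ‖u‖) (hu : ‖u‖ < 1 / q) :
    monicSeries (fun f => (dCount f : ℂ) * eFrac (c * f) g) u =
      ((q : ℂ) * u ^ 2) ^ ((g.natDegree : ℤ) - 1) *
        ∑ lam : Fˣ,
          (Kl2 (-1 : F) ((lam : F)) / (q : ℂ) +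
            (1 + (q : ℂ) - 2 * (q : ℂ) * u) / ((q : ℂ) * (1 - (q : ℂ) * u) ^ 2)) *
          φ lam (1 / ((q : ℂ) * u)) := by
  subst hq
  have := hg.finite_adjoinRoot
  have : Finite (AdjoinRoot g) := Module.finite_of_finite F
  let _ : Fintype (AdjoinRoot g) := Fintype.ofFinite _
  have hu0' : u ≠ 0 := norm_pos_iff.1 hu0
  have hcc : AdjoinRoot.mk g c * AdjoinRoot.mk g cbar = 1 := by
    rw [← map_mul, ← map_one (AdjoinRoot.mk g), AdjoinRoot.mk_eq_mk]
    exact hcbar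
  have hd (z : ℂ) : ((1 - C (Fintype.card F : ℂ) * X) ^ 2 : ℂ[X]).eval z =
      (1 - Fintype.card F * z) ^ 2 := by simp
  have hd0 {z : ℂ} : ((1 - C (Fintype.card F : ℂ) * X) ^ 2 : ℂ[X]).eval z ≠ 0 ↔
      Fintype.card F * z ≠ 1 := by
    rw [hd, Ne, sq_eq_zero_iff, sub_eq_zero, eq_comm]
  have hφv (β : Fˣ) : φ β (1 / (Fintype.card F * u)) =
      estermannRat hg (1 / (Fintype.card F * u)) ((β : F) • AdjoinRoot.mk g cbar) := by
    have hβ : AdjoinRoot.mk g (C (β : F) * cbar) = (β : F) • AdjoinRoot.mk g cbar := by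
      rw [← smul_eq_C_mul, AdjoinRoot.smul_mk]
    obtain ⟨p, hp⟩ := exists_eval_eq_estermannRat_mul hg ((β : F) • AdjoinRoot.mk g cbar)
    refine (hφ β).eq_of_eval_eq
      (ψ := fun z => estermannRat hg z ((β : F) • AdjoinRoot.mk g cbar))
      (d := (1 - C (Fintype.card F : ℂ) * X) ^ 2) (p := p)
      (fun z hz => by rw [hd]; exact hp z (hd0.1 hz)) (fun z hz => hd0.2 (card_mul_ne_one hz))
      (fun z hz => ?_) (hd0.2 ?_)
    · rw [← hβ]
      exact ((hφ β).2 z hz).unique (hasSum_estermannRat hg hz (C (β : F) * cbar))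
    · have hq0 : (Fintype.card F : ℂ) ≠ 0 := by exact_mod_cast Fintype.card_ne_zero
      have hu1 := ne_one_of_norm_lt hu
      intro h
      field_simp at h
      exact hu1 h.symm
  rw [monicSeries, (hasSum_estermannRat hg hu c).tsum_eq,
    estermannRat_functional_equation hg hgdeg hu0' hu hcc]
  simp only [hφv]
  rw [← zpow_natCast, Nat.cast_sub hgdeg, Nat.cast_one]
end

section
/- Let g, ℓ ∈ 𝔽_q[T] be monic with gcd(ℓ,g) = 1, let c ∈ 𝔽_q[T], and let χ be a primitive Dirichlet character modulo ℓ. Then for every u ∈ ℂ with 0 < |u| < 1/q, R_1(u;χ,c/g) = χ(g)·G(χ)·(qu)^{deg g − 1}·u^{deg ℓ} · Σ_{λ ∈ 𝔽_q^×} χ(−λ)·[ e_q(λ^{−1}) − 1/(1 − qu) ] · Z_{χ̄}(1/(qu); λcℓ, g), where Z_{χ̄}(·;λcℓ,g) is evaluated via its rational continuation; equivalently, the identity holds as an equality of rational functions of u. -/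
open Polynomial
open scoped Classical

section AdditiveCharacter

variable {F : Type} [Field F] [Fintype F]

lemma eChar_eq_stdAddChar [NeZero (ringChar F)] [Algebra (ZMod (ringChar F)) F] (y : F) :
    eChar F y = ZMod.stdAddChar (Algebra.trace (ZMod (ringChar F)) F y) := by
  rw [ZMod.stdAddChar_apply, ZMod.toCircle_apply, eChar]
  congr! <;> exact Subsingleton.elim _ _

lemma ringChar_neZero (F : Type) [Field F] [Fintype F] : NeZero (ringChar F) :=
  ⟨CharP.ringChar_ne_zero_of_finite F⟩

lemma eChar_zero : eChar F 0 = 1 := by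
  have := ringChar_neZero F
  let _ : Algebra (ZMod (ringChar F)) F := ZMod.algebra F (ringChar F)
  rw [eChar_eq_stdAddChar, map_zero, AddChar.map_zero_eq_one]

lemma eChar_add (x y : F) : eChar F (x + y) = eChar F x * eChar F y := by
  have := ringChar_neZero F
  let _ : Algebra (ZMod (ringChar F)) F := ZMod.algebra F (ringChar F)
  simp only [eChar_eq_stdAddChar, map_add, AddChar.map_add_eq_mul]

lemma norm_eChar (x : F) : ‖eChar F x‖ = 1 := by
  have := ringChar_neZero F
  let _ : Algebra (ZMod (ringChar F)) F := ZMod.algebra F (ringChar F)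
  rw [eChar_eq_stdAddChar, AddChar.norm_apply]

lemma exists_eChar_mul_ne_one {a : F} (ha : a ≠ 0) : ∃ b, eChar F (b * a) ≠ 1 := by
  have := ringChar_neZero F
  let _ : Algebra (ZMod (ringChar F)) F := ZMod.algebra F (ringChar F)
  obtain ⟨b, hb⟩ := FiniteField.trace_to_zmod_nondegenerate F ha
  refine ⟨b, fun h => hb ?_⟩
  rw [eChar_eq_stdAddChar, mul_comm,
    ← AddChar.map_zero_eq_one (ZMod.stdAddChar (N := ringChar F))] at h
  exact ZMod.injective_stdAddChar h

lemma sum_eChar : ∑ x : F, eChar F x = 0 := by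
  obtain ⟨b, hb⟩ := exists_eChar_mul_ne_one (one_ne_zero (α := F))
  rw [mul_one] at hb
  have h : ∑ x : F, eChar F x = eChar F b * ∑ x : F, eChar F x := by
    rw [Finset.mul_sum, ← Equiv.sum_comp (Equiv.addLeft b)]
    simp [eChar_add]
  have h' : (1 - eChar F b) * ∑ x : F, eChar F x = 0 := by linear_combination h
  exact (mul_eq_zero.1 h').resolve_left (sub_ne_zero.2 (Ne.symm hb))

lemma sum_eChar_units_inv : ∑ x : Fˣ, eChar F ((x⁻¹ : Fˣ) : F) = -1 := by
  refine (Equiv.sum_comp (Equiv.inv Fˣ) (fun x : Fˣ => eChar F (x : F))).trans ?_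
  have h := sum_eChar (F := F)
  rw [← Finset.add_sum_erase _ _ (Finset.mem_univ (0 : F)), eChar_zero] at h
  rw [eq_neg_iff_add_eq_zero, add_comm, ← h]
  congr 1
  refine Finset.sum_bij (fun x _ => (x : F)) (by simp) (fun _ _ _ _ h => Units.ext h) ?_ (by simp)
  intro b hb
  exact ⟨Units.mk0 b (by simpa using hb), by simp, rfl⟩

lemma eFrac_add (a b g : F[X]) : eFrac (a + b) g = eFrac a g * eFrac b g := by
  simp only [eFrac, Polynomial.add_mod, coeff_add, eChar_add]

lemma eFrac_congr {a b g : F[X]} (h : a % g = b % g) : eFrac a g = eFrac b g := by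
  simp only [eFrac, h]

lemma eFrac_eq_one_of_dvd {a g : F[X]} (h : g ∣ a) : eFrac a g = 1 := by
  rw [eFrac, EuclideanDomain.mod_eq_zero.2 h, coeff_zero, eChar_zero]

lemma norm_eFrac (a g : F[X]) : ‖eFrac a g‖ = 1 := norm_eChar _

lemma eFrac_eq_of_degree_lt {a g : F[X]} (h : a.degree < g.degree) :
    eFrac a g = eChar F (a.coeff (g.natDegree - 1)) := by
  rw [eFrac, (Polynomial.mod_eq_self_iff (by rintro rfl; simp at h)).2 h]

omit [Fintype F] in
lemma mod_congr_of_dvd {a b h k : F[X]} (hk : k ∣ h) (e : a % h = b % h) : a % k = b % k := by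
  refine Polynomial.mod_eq_of_dvd_sub (hk.trans ?_)
  rw [← EuclideanDomain.mod_eq_zero, Polynomial.sub_mod, e, sub_self]

omit [Fintype F] in
lemma mul_mod_congr {a b k : F[X]} (c : F[X]) (e : a % k = b % k) : (c * a) % k = (c * b) % k := by
  rw [Polynomial.mul_mod, e, ← Polynomial.mul_mod]

/-- Cancelling a common monic factor: `e(aℓ/(gℓ)) = e(a/g)`. -/
lemma eFrac_mul_mul {g ℓ : F[X]} (hg : g.Monic) (hℓ : ℓ.Monic) (a : F[X]) :
    eFrac (a * ℓ) (g * ℓ) = eFrac a g := by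
  have h1 : (a * ℓ) % (g * ℓ) = (a % g) * ℓ := by
    rw [← Polynomial.modByMonic_eq_mod _ (hg.mul hℓ)]
    refine (Polynomial.div_modByMonic_unique (a / g) _ (hg.mul hℓ) ⟨?_, ?_⟩).2
    · linear_combination ℓ * EuclideanDomain.mod_add_div a g
    · rw [degree_mul, degree_mul]
      have : ℓ.degree ≠ ⊥ := by rw [Ne, degree_eq_bot]; exact hℓ.ne_zero
      exact WithBot.add_lt_add_right this (Polynomial.degree_mod_lt a hg.ne_zero)
  rw [eFrac, eFrac, h1, hg.natDegree_mul hℓ]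
  rcases Nat.eq_zero_or_pos g.natDegree with h0 | h0
  · rw [hg.natDegree_eq_zero.1 h0]
    simp
  · congr 1
    have hd : (a % g).natDegree ≤ g.natDegree - 1 := by
      have := Polynomial.natDegree_mod_lt a h0.ne'
      omega
    rw [show g.natDegree + ℓ.natDegree - 1 = (g.natDegree - 1) + ℓ.natDegree by omega,
      coeff_mul_add_eq_of_natDegree_le hd le_rfl, hℓ.coeff_natDegree, mul_one]

end AdditiveCharacter

section PolynomialsOfBoundedDegree

/-- The finite set of polynomials of degree less than `n`. -/
noncomputable def polysLT (F : Type) [Field F] [Fintype F] (n : ℕ) : Finset F[X] :=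
  haveI : Finite (degreeLT F n) := Finite.of_equiv _ (degreeLTEquiv F n).toEquiv.symm
  (Set.toFinite (degreeLT F n : Set F[X])).toFinset

variable {F : Type} [Field F] [Fintype F]

@[simp] lemma mem_polysLT {n : ℕ} {f : F[X]} : f ∈ polysLT F n ↔ f.degree < n := by
  simp [polysLT, mem_degreeLT]

lemma card_polysLT (n : ℕ) : (polysLT F n).card = Fintype.card F ^ n := by
  have e : {f // f ∈ polysLT F n} ≃ (Fin n → F) :=
    (Equiv.subtypeEquivRight fun f => by rw [mem_polysLT, mem_degreeLT]).trans
      (degreeLTEquiv F n).toEquiv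
  rw [← Fintype.card_coe, Fintype.card_congr e]
  simp

lemma polysLT_zero : polysLT F 0 = {0} := by
  ext f
  simp [Nat.WithBot.lt_zero_iff]

lemma mem_polysLT_add {n : ℕ} {f s : F[X]} (hs : s ∈ polysLT F n) (hf : f ∈ polysLT F n) :
    f + s ∈ polysLT F n := by
  rw [mem_polysLT] at *
  exact (degree_add_le f s).trans_lt (max_lt hf hs)

lemma sum_polysLT_shift {n : ℕ} {s : F[X]} (hs : s ∈ polysLT F n) (φ : F[X] → ℂ) :
    ∑ f ∈ polysLT F n, φ (f + s) = ∑ f ∈ polysLT F n, φ f := by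
  have hs' : -s ∈ polysLT F n := by simpa using hs
  refine Finset.sum_bij' (fun f _ => f + s) (fun f _ => f + -s)
    (fun f hf => mem_polysLT_add hs hf) (fun f hf => mem_polysLT_add hs' hf) ?_ ?_ ?_ <;> simp

/-- A nontrivial additive character sums to zero. -/
lemma sum_polysLT_eq_zero {n : ℕ} {ψ : F[X] → ℂ} (hψ : ∀ a b, ψ (a + b) = ψ a * ψ b)
    {s : F[X]} (hs : s ∈ polysLT F n) (h1 : ψ s ≠ 1) : ∑ f ∈ polysLT F n, ψ f = 0 := by
  have h := sum_polysLT_shift hs ψ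
  simp only [hψ, ← Finset.sum_mul] at h
  have h' : (∑ f ∈ polysLT F n, ψ f) * (ψ s - 1) = 0 := by linear_combination h
  exact (mul_eq_zero.1 h').resolve_right (sub_ne_zero.2 h1)

/-- Division with remainder by a monic polynomial, as a reindexing of sums. -/
lemma sum_polysLT_add {h : F[X]} (hh : h.Monic) (b : ℕ) (φ : F[X] → ℂ) :
    ∑ f ∈ polysLT F (h.natDegree + b), φ f =
      ∑ r ∈ polysLT F h.natDegree, ∑ s ∈ polysLT F b, φ (r + h * s) := by
  have hd : h.degree = (h.natDegree : WithBot ℕ) := degree_eq_natDegree hh.ne_zero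
  have hmod : ∀ r s : F[X], r.degree < h.natDegree →
      (r + h * s) / h = s ∧ (r + h * s) % h = r := by
    intro r s hr
    rw [← Polynomial.modByMonic_eq_mod _ hh, ← Polynomial.divByMonic_eq_div _ hh]
    exact Polynomial.div_modByMonic_unique s r hh ⟨rfl, hd ▸ hr⟩
  have hdeg : ∀ s : F[X], (h * s).degree < (h.natDegree + b : ℕ) ↔ s.degree < b := by
    intro s
    by_cases hs : s = 0
    · simp [hs]
    · rw [degree_mul, hd, degree_eq_natDegree hs]
      norm_cast
      omega
  rw [← Finset.sum_product']
  refine Finset.sum_bij' (fun f _ => (f % h, f / h)) (fun x _ => x.1 + h * x.2) ?_ ?_ ?_ ?_ ?_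
  · intro f hf
    rw [mem_polysLT] at hf
    have h1 : (f % h).degree < h.natDegree := hd ▸ Polynomial.degree_mod_lt f hh.ne_zero
    rw [Finset.mem_product, mem_polysLT, mem_polysLT]
    refine ⟨h1, (hdeg _).1 ?_⟩
    rw [show h * (f / h) = f - f % h by linear_combination EuclideanDomain.mod_add_div f h]
    refine (degree_sub_le _ _).trans_lt (max_lt hf (h1.trans_le ?_))
    exact_mod_cast Nat.le_add_right _ _
  · rintro ⟨r, s⟩ hx
    rw [Finset.mem_product, mem_polysLT, mem_polysLT] at hx
    rw [mem_polysLT]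
    refine (degree_add_le _ _).trans_lt (max_lt (hx.1.trans_le ?_) ((hdeg _).2 hx.2))
    exact_mod_cast Nat.le_add_right _ _
  · intro f _
    exact EuclideanDomain.mod_add_div f h
  · rintro ⟨r, s⟩ hx
    rw [Finset.mem_product, mem_polysLT, mem_polysLT] at hx
    exact Prod.ext (hmod r s hx.1).2 (hmod r s hx.1).1
  · intro f _
    simp only [EuclideanDomain.mod_add_div]

/-- Multiplication by a unit permutes the residues. -/
lemma sum_polysLT_mul {h a : F[X]} (hh : h.Monic) (ha : IsCoprime a h) {φ : F[X] → ℂ}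
    (hφ : ∀ x y, x % h = y % h → φ x = φ y) :
    ∑ f ∈ polysLT F h.natDegree, φ (a * f) = ∑ f ∈ polysLT F h.natDegree, φ f := by
  have hd : h.degree = (h.natDegree : WithBot ℕ) := degree_eq_natDegree hh.ne_zero
  obtain ⟨x, y, hxy⟩ := ha
  have key : ∀ s t f : F[X], h ∣ s * t - 1 → f.degree < h.natDegree →
      (s * ((t * f) % h)) % h = f := by
    intro s t f hst hf
    rw [← hd, ← Polynomial.mod_eq_self_iff hh.ne_zero] at hf
    conv_rhs => rw [← hf]
    rw [mul_mod_congr s (Polynomial.mod_eq_of_dvd_sub (p₂ := t * f) _)]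
    · refine Polynomial.mod_eq_of_dvd_sub ?_
      obtain ⟨k, hk⟩ := hst
      exact ⟨k * f, by linear_combination f * hk⟩
    · exact ⟨-((t * f) / h), by linear_combination EuclideanDomain.mod_add_div (t * f) h⟩
  refine Finset.sum_bij' (fun f _ => (a * f) % h) (fun f _ => (x * f) % h) ?_ ?_ ?_ ?_ ?_
  · intro f _
    rw [mem_polysLT, ← hd]
    exact Polynomial.degree_mod_lt _ hh.ne_zero
  · intro f _
    rw [mem_polysLT, ← hd]
    exact Polynomial.degree_mod_lt _ hh.ne_zero
  · intro f hf
    exact key x a f ⟨-y, by linear_combination hxy⟩ (mem_polysLT.1 hf)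
  · intro f hf
    exact key a x f ⟨-y, by linear_combination hxy⟩ (mem_polysLT.1 hf)
  · intro f _
    exact hφ _ _ (Polynomial.mod_eq_of_dvd_sub
      ⟨(a * f) / h, by linear_combination -EuclideanDomain.mod_add_div (a * f) h⟩)

/-- Sums over monic polynomials of degree `n`, with an arbitrary monic centre. -/
lemma sum_polysLT_monic_center {n : ℕ} {p : F[X]} (hp : p.Monic) (hn : p.natDegree = n)
    (φ : F[X] → ℂ) :
    ∑ f ∈ polysLT F n, φ (X ^ n + f) = ∑ f ∈ polysLT F n, φ (p + f) := by
  have hs : p - X ^ n ∈ polysLT F n := by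
    rw [mem_polysLT]
    have h1 : p.degree = n := by rw [degree_eq_natDegree hp.ne_zero, hn]
    rw [← h1]
    exact degree_sub_lt_left (by rw [h1, degree_X_pow]) hp.ne_zero (by simp [hp.leadingCoeff])
  rw [← sum_polysLT_shift hs]
  refine Finset.sum_congr rfl fun f _ => ?_
  congr 1
  ring

/-- Nonzero polynomials are scalar multiples of monic ones. -/
lemma sum_polysLT_erase_zero (n : ℕ) (φ : F[X] → ℂ) :
    ∑ f ∈ (polysLT F n).erase 0, φ f =
      ∑ lam : Fˣ, ∑ k ∈ Finset.range n, ∑ f ∈ polysLT F k,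
        φ (C ((lam⁻¹ : Fˣ) : F) * (X ^ k + f)) := by
  have hm : ∀ (k : ℕ) (f : F[X]), f.degree < k → (X ^ k + f).Monic ∧ (X ^ k + f).natDegree = k := by
    intro k f hf
    refine ⟨monic_X_pow_add hf, ?_⟩
    refine natDegree_eq_of_degree_eq_some ?_
    rw [degree_add_eq_left_of_degree_lt (by rwa [degree_X_pow]), degree_X_pow]
  have hsig : ∀ lam : Fˣ, ∑ k ∈ Finset.range n, ∑ f ∈ polysLT F k,
        φ (C ((lam⁻¹ : Fˣ) : F) * (X ^ k + f)) =
      ∑ x ∈ (Finset.range n).sigma (fun k => polysLT F k),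
        φ (C ((lam⁻¹ : Fˣ) : F) * (X ^ x.1 + x.2)) := fun lam =>
    (Finset.sum_sigma (Finset.range n) (fun k => polysLT F k) (fun x =>
      φ (C ((lam⁻¹ : Fˣ) : F) * (X ^ x.1 + x.2)))).symm
  simp_rw [hsig]
  rw [← Finset.sum_product']
  symm
  refine Finset.sum_bij (fun x _ => C ((x.1⁻¹ : Fˣ) : F) * (X ^ x.2.1 + x.2.2)) ?_ ?_ ?_ ?_
  · rintro ⟨lam, k, f⟩ hx
    simp only [Finset.mem_product, Finset.mem_univ, Finset.mem_sigma, Finset.mem_range,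
      mem_polysLT, true_and] at hx
    obtain ⟨h1, h2⟩ := hm k f hx.2
    have h0 : C ((lam⁻¹ : Fˣ) : F) * (X ^ k + f) ≠ 0 :=
      mul_ne_zero (by rw [Ne, C_eq_zero]; exact Units.ne_zero _) h1.ne_zero
    rw [Finset.mem_erase, mem_polysLT]
    refine ⟨h0, ?_⟩
    rw [← natDegree_lt_iff_degree_lt h0, natDegree_C_mul (Units.ne_zero _), h2]
    exact hx.1
  · rintro ⟨lam, k, f⟩ hx ⟨lam', k', f'⟩ hx' h
    simp only [Finset.mem_product, Finset.mem_univ, Finset.mem_sigma, Finset.mem_range,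
      mem_polysLT, true_and] at hx hx' h
    obtain ⟨h1, h2⟩ := hm k f hx.2
    obtain ⟨h1', h2'⟩ := hm k' f' hx'.2
    have e1 := congrArg leadingCoeff h
    have e2 := congrArg natDegree h
    rw [natDegree_C_mul (Units.ne_zero _), natDegree_C_mul (Units.ne_zero _), h2, h2'] at e2
    rw [leadingCoeff_mul, leadingCoeff_mul, h1, h1', leadingCoeff_C, leadingCoeff_C, mul_one,
      mul_one, Units.val_inj, inv_inj] at e1
    subst e1 e2
    have e3 := mul_left_cancel₀ (by rw [Ne, C_eq_zero]; exact Units.ne_zero _) h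
    rw [add_left_cancel e3]
  · intro f hf
    rw [Finset.mem_erase, mem_polysLT] at hf
    have hl : f.leadingCoeff ≠ 0 := leadingCoeff_ne_zero.2 hf.1
    have hmon : (C f.leadingCoeff⁻¹ * f).Monic := by
      rw [Monic, leadingCoeff_mul, leadingCoeff_C, inv_mul_cancel₀ hl]
    have hdeg : (C f.leadingCoeff⁻¹ * f).degree = f.natDegree := by
      rw [degree_C_mul (inv_ne_zero hl), degree_eq_natDegree hf.1]
    refine ⟨⟨(Units.mk0 _ hl)⁻¹, f.natDegree, C f.leadingCoeff⁻¹ * f - X ^ f.natDegree⟩, ?_, ?_⟩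
    · simp only [Finset.mem_product, Finset.mem_univ, Finset.mem_sigma, Finset.mem_range,
        mem_polysLT, true_and]
      refine ⟨(natDegree_lt_iff_degree_lt hf.1).2 hf.2, ?_⟩
      rw [← hdeg]
      exact degree_sub_lt_left (by rw [hdeg, degree_X_pow]) hmon.ne_zero (by simp [hmon.leadingCoeff])
    · simp only [inv_inv, Units.val_mk0, add_sub_cancel]
      rw [← mul_assoc, ← C_mul, mul_inv_cancel₀ hl, C_1, one_mul]
  · intro _ _
    rfl

end PolynomialsOfBoundedDegree

section ExponentialSums

variable {F : Type} [Field F] [Fintype F]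

lemma exists_eFrac_ne_one {h y : F[X]} {n : ℕ} (hy0 : y ≠ 0)
    (hy : y.degree < h.degree) (hn : h.natDegree < n + 1 + y.natDegree) :
    ∃ s ∈ polysLT F n, eFrac (s * y) h ≠ 1 := by
  obtain ⟨b, hb⟩ := exists_eChar_mul_ne_one (leadingCoeff_ne_zero.2 hy0)
  have hk : y.natDegree < h.natDegree := natDegree_lt_natDegree hy0 hy
  have hdeg : (C b * X ^ (h.natDegree - 1 - y.natDegree)).degree ≤
      ((h.natDegree - 1 - y.natDegree : ℕ) : WithBot ℕ) := degree_C_mul_X_pow_le _ _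
  refine ⟨C b * X ^ (h.natDegree - 1 - y.natDegree), ?_, ?_⟩
  · rw [mem_polysLT]
    refine hdeg.trans_lt ?_
    exact_mod_cast (by omega : h.natDegree - 1 - y.natDegree < n)
  · rw [eFrac_eq_of_degree_lt]
    · rw [mul_assoc, coeff_C_mul, coeff_X_pow_mul', if_pos (by omega),
        show h.natDegree - 1 - (h.natDegree - 1 - y.natDegree) = y.natDegree by omega]
      exact hb
    · rw [degree_eq_natDegree (p := h) (by rintro rfl; simp at hk)]
      refine (degree_mul_le _ _).trans_lt ((add_le_add hdeg degree_le_natDegree).trans_lt ?_)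
      exact_mod_cast (by omega : h.natDegree - 1 - y.natDegree + y.natDegree < h.natDegree)

/-- Orthogonality of the additive characters modulo `h`. -/
lemma sum_eFrac_mul {h : F[X]} (hh : h.Monic) (y : F[X]) :
    ∑ s ∈ polysLT F h.natDegree, eFrac (s * y) h =
      if h ∣ y then (Fintype.card F : ℂ) ^ h.natDegree else 0 := by
  split_ifs with hy
  · rw [Finset.sum_congr rfl fun s _ => eFrac_eq_one_of_dvd (hy.mul_left s)]
    simp [card_polysLT]
  · have hr : y % h ≠ 0 := fun e => hy (EuclideanDomain.mod_eq_zero.1 e)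
    have hlt := Polynomial.degree_mod_lt y hh.ne_zero
    obtain ⟨s, hs, h1⟩ := exists_eFrac_ne_one (n := h.natDegree) hr hlt (by omega)
    have hm : ∀ s, eFrac (s * y) h = eFrac (s * (y % h)) h := fun s =>
      eFrac_congr (mul_mod_congr s
        ((Polynomial.mod_eq_self_iff hh.ne_zero).2 hlt).symm)
    simp only [hm]
    exact sum_polysLT_eq_zero (ψ := fun s => eFrac (s * (y % h)) h)
      (fun a b => by rw [add_mul, eFrac_add]) hs h1

/-- The exponential sum over monic polynomials of degree `n`. -/
lemma sum_monic_eFrac {h m : F[X]} (hm0 : m ≠ 0) (hm : m.degree < h.degree) (n : ℕ) :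
    ∑ f ∈ polysLT F n, eFrac ((X ^ n + f) * m) h =
      if n + 1 + m.natDegree < h.natDegree then (Fintype.card F : ℂ) ^ n
      else if n + 1 + m.natDegree = h.natDegree then
        (Fintype.card F : ℂ) ^ n * eChar F m.leadingCoeff
      else 0 := by
  have hk : m.natDegree < h.natDegree := natDegree_lt_natDegree hm0 hm
  have hh0 : h ≠ 0 := by rintro rfl; simp at hk
  have key : n + 1 + m.natDegree ≤ h.natDegree → ∀ f ∈ polysLT F n,
      eFrac ((X ^ n + f) * m) h = eChar F (m.coeff (h.natDegree - 1 - n)) := by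
    intro hle f hf
    rw [mem_polysLT] at hf
    have hnd : (X ^ n + f).natDegree ≤ n :=
      natDegree_add_le_of_degree_le (natDegree_X_pow_le n)
        (natDegree_le_of_degree_le hf.le)
    rw [eFrac_eq_of_degree_lt]
    · congr 1
      have hfm : (f * m).coeff (h.natDegree - 1) = 0 := by
        by_cases hf0 : f = 0
        · simp [hf0]
        refine coeff_eq_zero_of_natDegree_lt ?_
        rw [natDegree_mul hf0 hm0]
        have := (natDegree_lt_iff_degree_lt hf0).2 hf
        omega
      rw [add_mul, coeff_add, hfm, add_zero, coeff_X_pow_mul', if_pos (by omega)]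
    · refine degree_lt_degree ?_
      refine natDegree_mul_le.trans_lt ?_
      omega
  split_ifs with h1 h2
  · rw [Finset.sum_congr rfl (key h1.le), coeff_eq_zero_of_natDegree_lt (by omega), eChar_zero]
    simp [card_polysLT]
  · rw [Finset.sum_congr rfl (key h2.le), show h.natDegree - 1 - n = m.natDegree by omega,
      coeff_natDegree]
    simp [card_polysLT]
  · obtain ⟨s, hs, hs1⟩ := exists_eFrac_ne_one (n := n) hm0 hm (by omega)
    simp only [add_mul, eFrac_add, ← Finset.mul_sum]
    rw [sum_polysLT_eq_zero (ψ := fun s => eFrac (s * m) h)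
      (fun a b => by rw [add_mul, eFrac_add]) hs hs1, mul_zero]

end ExponentialSums

section DirichletCharacters

variable {F : Type} [Field F] [Fintype F]

omit [Fintype F] in
/-- Units modulo a divisor lift to units. -/
lemma exists_isCoprime_add_mul {f ℓ ℓ' : F[X]} (hℓ : ℓ ≠ 0) (hf : IsCoprime f ℓ') :
    ∃ k, IsCoprime (f + k * ℓ') ℓ := by
  obtain ⟨S, hS⟩ : ∃ S : Finset F[X], ∀ p, p ∈ S ↔
      p ∈ UniqueFactorizationMonoid.normalizedFactors ℓ ∧ ¬ p ∣ f :=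
    ⟨(UniqueFactorizationMonoid.normalizedFactors ℓ).toFinset.filter fun p => ¬ p ∣ f,
      fun p => by rw [Finset.mem_filter, Multiset.mem_toFinset]⟩
  refine ⟨∏ p ∈ S, p, isCoprime_of_prime_dvd (fun h => hℓ h.2) fun z hz h1 h2 => ?_⟩
  obtain ⟨p, hp, hzp⟩ :=
    UniqueFactorizationMonoid.exists_mem_normalizedFactors_of_dvd hℓ hz.irreducible h2
  by_cases hzf : z ∣ f
  · have h3 : z ∣ (∏ p ∈ S, p) * ℓ' := (dvd_add_right hzf).1 h1
    rcases hz.dvd_or_dvd h3 with h4 | h4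
    · obtain ⟨r, hr, hzr⟩ := (hz.dvd_finsetProd_iff _).1 h4
      rw [hS] at hr
      have hir := UniqueFactorizationMonoid.irreducible_of_normalized_factor r hr.1
      exact hr.2 (((hz.irreducible.associated_of_dvd hir hzr).dvd_iff_dvd_left).1 hzf)
    · exact hz.not_isUnit (hf.isUnit_of_dvd' hzf h4)
  · have hpS : p ∈ S := by
      rw [hS]
      exact ⟨hp, fun h => hzf (hzp.dvd.trans h)⟩
    have h3 : z ∣ (∏ p ∈ S, p) * ℓ' :=
      (hzp.dvd.trans (Finset.dvd_prod_of_mem (fun p => p) hpS)).mul_right _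
    exact hzf ((dvd_add_left h3).1 h1)

omit [Fintype F] in
lemma isCoprime_of_mod_eq {a b h : F[X]} (e : a % h = b % h) (ha : IsCoprime a h) :
    IsCoprime b h := by
  rw [show b = a + h * (b / h - a / h) by
    linear_combination EuclideanDomain.mod_add_div a h - EuclideanDomain.mod_add_div b h - e]
  exact ha.add_mul_left_left _

omit [Fintype F] in
lemma isCoprime_iff_of_mod_eq {a b h : F[X]} (e : a % h = b % h) :
    IsCoprime a h ↔ IsCoprime b h :=
  ⟨isCoprime_of_mod_eq e, isCoprime_of_mod_eq e.symm⟩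

omit [Fintype F] in
/-- A primitive character is nontrivial on the units congruent to `1` modulo a proper divisor. -/
lemma IsPrimitiveChar.exists_ne_one {ℓ ℓ' : F[X]} {χ : F[X] → ℂ} (hχ : IsPrimitiveChar ℓ χ)
    (hℓ : ℓ.Monic) (hℓ' : ℓ'.Monic) (hd : ℓ' ∣ ℓ) (hne : ℓ' ≠ ℓ) :
    ∃ a, IsCoprime a ℓ ∧ a % ℓ' = 1 % ℓ' ∧ χ a ≠ 1 := by
  by_contra! hcon
  obtain ⟨⟨hper, hmul, hone, hzero⟩, hprim⟩ := hχ
  have hwd : ∀ a b, IsCoprime a ℓ → IsCoprime b ℓ → a % ℓ' = b % ℓ' → χ a = χ b := by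
    intro a b ha hb hab
    obtain ⟨x, y, hxy⟩ := ha
    have hx : IsCoprime x ℓ := ⟨a, y, by linear_combination hxy⟩
    have h1 : (x * a) % ℓ' = 1 % ℓ' := by
      obtain ⟨k, hk⟩ := hd
      exact Polynomial.mod_eq_of_dvd_sub ⟨-y * k, by linear_combination hxy - y * hk⟩
    have h2 : χ (x * a) = 1 := hcon _ (hx.mul_left ⟨x, y, hxy⟩) h1
    have h3 : χ (x * b) = 1 := hcon _ (hx.mul_left hb) (by rw [← mul_mod_congr x hab, h1])
    rw [hmul] at h2 h3
    have h4 : χ x ≠ 0 := fun h => by simp [h] at h2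
    exact mul_left_cancel₀ h4 (h2.trans h3.symm)
  choose! k hk using fun f (hf : IsCoprime f ℓ') => exists_isCoprime_add_mul hℓ.ne_zero hf
  have hmod : ∀ f, (f + k f * ℓ') % ℓ' = f % ℓ' := fun f =>
    Polynomial.mod_eq_of_dvd_sub ⟨k f, by ring⟩
  refine hprim ℓ' hℓ' hd hne
    ⟨fun f => if IsCoprime f ℓ' then χ (f + k f * ℓ') else 0, ⟨?_, ?_, ?_, ?_⟩, ?_⟩
  · intro f g hfg
    simp only [isCoprime_iff_of_mod_eq hfg]
    split_ifs with hg
    · exact hwd _ _ (hk f ((isCoprime_iff_of_mod_eq hfg).2 hg)) (hk g hg)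
        (by rw [hmod, hmod, hfg])
    · rfl
  · intro f g
    by_cases hf : IsCoprime f ℓ'
    · by_cases hg : IsCoprime g ℓ'
      · simp only [hf.mul_left hg, hf, hg, if_true, ← hmul]
        refine hwd _ _ (hk _ (hf.mul_left hg)) ((hk f hf).mul_left (hk g hg)) ?_
        rw [hmod, Polynomial.mul_mod (f + _), hmod, hmod, ← Polynomial.mul_mod]
      · simp only [if_neg hg, if_neg fun h : IsCoprime (f * g) ℓ' => hg h.of_mul_left_right,
          mul_zero]
    · simp only [if_neg hf, if_neg fun h : IsCoprime (f * g) ℓ' => hf h.of_mul_left_left,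
        zero_mul]
  · simp only [isCoprime_one_left, if_true]
    exact hcon _ (hk 1 isCoprime_one_left) (hmod 1)
  · intro f
    by_cases hf : IsCoprime f ℓ'
    · simp [hf, hzero, hk f hf]
    · simp [hf]
  · intro f hf
    have hf' : IsCoprime f ℓ' := hf.of_isCoprime_of_dvd_right hd
    simp only [hf', if_true]
    exact hwd _ _ hf (hk f hf') (hmod f).symm

omit [Fintype F] in
lemma IsDirichletChar.norm_eq_one [Finite F] {ℓ : F[X]} {χ : F[X] → ℂ} (hχ : IsDirichletChar ℓ χ)
    (hℓ : ℓ.Monic) {a : F[X]} (ha : IsCoprime a ℓ) : ‖χ a‖ = 1 := by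
  have := Fintype.ofFinite F
  obtain ⟨hper, hmul, hone, hzero⟩ := hχ
  have hpow : ∀ n : ℕ, χ (a ^ n) = χ a ^ n := by
    intro n
    induction n with
    | zero => simp [hone]
    | succ n ih => rw [pow_succ, hmul, ih, pow_succ]
  have hlt : ∀ n : ℕ, a ^ n % ℓ ∈ polysLT F ℓ.natDegree := fun n => by
    rw [mem_polysLT, ← degree_eq_natDegree hℓ.ne_zero]
    exact Polynomial.degree_mod_lt _ hℓ.ne_zero
  obtain ⟨i, j, hij, he⟩ := Finite.exists_ne_map_eq_of_infinite
    fun n : ℕ => (⟨a ^ n % ℓ, hlt n⟩ : polysLT F ℓ.natDegree)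
  have he' := congrArg norm (hper _ _ (Subtype.ext_iff.1 he))
  rw [hpow, hpow, norm_pow, norm_pow] at he'
  have hpos : 0 < ‖χ a‖ := norm_pos_iff.2 fun h => (hzero a).1 h ha
  by_contra hne
  exact hij (pow_right_injective₀ hpos hne he')

lemma IsDirichletChar.norm_le_one {ℓ : F[X]} {χ : F[X] → ℂ} (hχ : IsDirichletChar ℓ χ)
    (hℓ : ℓ.Monic) (a : F[X]) : ‖χ a‖ ≤ 1 := by
  by_cases ha : IsCoprime a ℓ
  · exact (hχ.norm_eq_one hℓ ha).le
  · simp [(hχ.2.2.2 a).2 ha]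

lemma IsDirichletChar.mul_conjChar {ℓ : F[X]} {χ : F[X] → ℂ} (hχ : IsDirichletChar ℓ χ)
    (hℓ : ℓ.Monic) {a : F[X]} (ha : IsCoprime a ℓ) : χ a * conjChar χ a = 1 := by
  rw [conjChar, Complex.mul_conj, Complex.normSq_eq_norm_sq, hχ.norm_eq_one hℓ ha]
  simp

omit [Fintype F] in
lemma conjChar_mul {ℓ : F[X]} {χ : F[X] → ℂ} (hχ : IsDirichletChar ℓ χ) (a b : F[X]) :
    conjChar χ (a * b) = conjChar χ a * conjChar χ b := by
  simp only [conjChar, hχ.2.1, map_mul]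

lemma GSum_eq_sum {ℓ : F[X]} (hℓ : ℓ.Monic) (χ : F[X] → ℂ) :
    GSum ℓ χ = ∑ a ∈ polysLT F ℓ.natDegree, χ a * eFrac a ℓ := by
  have h : {a : F[X] | a.degree < ℓ.degree} = (polysLT F ℓ.natDegree : Set F[X]) := by
    ext a
    simp [degree_eq_natDegree hℓ.ne_zero]
  rw [GSum, h, finsum_mem_coe_finset]

/-- Separability of the Gauss sum of a primitive character. -/
lemma IsPrimitiveChar.sum_mul_eFrac {ℓ : F[X]} {χ : F[X] → ℂ} (hχ : IsPrimitiveChar ℓ χ)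
    (hℓ : ℓ.Monic) (m : F[X]) :
    ∑ a ∈ polysLT F ℓ.natDegree, χ a * eFrac (a * m) ℓ = GSum ℓ χ * conjChar χ m := by
  have hper := hχ.1.1
  have hmul := hχ.1.2.1
  by_cases hm : IsCoprime m ℓ
  · rw [GSum_eq_sum hℓ, ← sum_polysLT_mul hℓ hm (φ := fun a => χ a * eFrac a ℓ)
      fun x y h => by rw [hper x y h, eFrac_congr h], Finset.sum_mul]
    refine Finset.sum_congr rfl fun a _ => ?_
    rw [hmul, mul_comm m a]
    linear_combination (-χ a * eFrac (a * m) ℓ) * hχ.1.mul_conjChar hℓ hm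
  · rw [conjChar, (hχ.1.2.2.2 m).2 hm, map_zero, mul_zero]
    have hdm : gcd m ℓ ≠ 0 := fun h => hℓ.ne_zero ((gcd_eq_zero_iff _ _).1 h).2
    obtain ⟨m', hm'⟩ := gcd_dvd_left m ℓ
    obtain ⟨ℓ', hℓ'⟩ := gcd_dvd_right m ℓ
    have hmon : (gcd m ℓ).Monic := by
      rw [← normalize_gcd]
      exact monic_normalize hdm
    have hmon' : ℓ'.Monic := hmon.of_mul_monic_left (hℓ' ▸ hℓ)
    have hne : ℓ' ≠ ℓ := by
      intro h
      rw [h] at hℓ'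
      have h1 : gcd m ℓ = 1 := by
        refine mul_right_cancel₀ hℓ.ne_zero ?_
        rw [one_mul]; exact hℓ'.symm
      exact hm ((gcd_isUnit_iff m ℓ).1 (by rw [h1]; exact isUnit_one))
    obtain ⟨a, ha, ha1, hχa⟩ := hχ.exists_ne_one hℓ hmon' ⟨gcd m ℓ, by rw [mul_comm]; exact hℓ'⟩ hne
    have hs := sum_polysLT_mul hℓ ha (φ := fun b => χ b * eFrac (b * m) ℓ)
      fun x y h => by
        rw [hper x y h, mul_comm x, mul_comm y, eFrac_congr (mul_mod_congr m h)]
    have he : ∀ b, χ (a * b) * eFrac (a * b * m) ℓ = χ a * (χ b * eFrac (b * m) ℓ) := by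
      intro b
      have : (a * b * m) % ℓ = (b * m) % ℓ := by
        obtain ⟨t, ht⟩ : ℓ' ∣ a - 1 := by
          rw [← EuclideanDomain.mod_eq_zero, Polynomial.sub_mod, ha1, sub_self]
        refine Polynomial.mod_eq_of_dvd_sub ⟨t * b * m', ?_⟩
        linear_combination b * m * ht + ℓ' * t * b * hm' - t * b * m' * hℓ'
      rw [hmul, eFrac_congr this, mul_assoc]
    simp only [he, ← Finset.mul_sum] at hs
    have h' : (χ a - 1) * ∑ b ∈ polysLT F ℓ.natDegree, χ b * eFrac (b * m) ℓ = 0 := by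
      linear_combination hs
    exact (mul_eq_zero.1 h').resolve_left (sub_ne_zero.2 hχa)

end DirichletCharacters

section MonicSeries

variable {F : Type} [Field F] [Fintype F]

/-- A monic polynomial is `X ^ n` plus a polynomial of smaller degree. -/
noncomputable def sigmaPolysLTEquivMonic (F : Type) [Field F] [Fintype F] :
    (Σ n : ℕ, polysLT F n) ≃ {f : F[X] // f.Monic} :=
  Equiv.ofBijective
    (fun x => ⟨X ^ x.1 + (x.2 : F[X]), monic_X_pow_add (mem_polysLT.1 x.2.2)⟩) <| by
    constructor
    · rintro ⟨n, f, hf⟩ ⟨k, p, hp⟩ h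
      have h' : X ^ n + f = X ^ k + p := Subtype.ext_iff.1 h
      have hd := congrArg degree h'
      rw [degree_add_eq_left_of_degree_lt (by simpa using hf),
        degree_add_eq_left_of_degree_lt (by simpa using hp), degree_X_pow, degree_X_pow] at hd
      obtain rfl : n = k := by exact_mod_cast hd
      obtain rfl := add_left_cancel h'
      rfl
    · rintro ⟨f, hf⟩
      have hd : f.degree = f.natDegree := degree_eq_natDegree hf.ne_zero
      refine ⟨⟨f.natDegree, f - X ^ f.natDegree, ?_⟩, Subtype.ext (add_sub_cancel _ _)⟩
      rw [mem_polysLT, ← hd]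
      exact degree_sub_lt_left (by rw [hd, degree_X_pow]) hf.ne_zero (by simp [hf.leadingCoeff])

lemma natDegree_sigmaPolysLTEquivMonic (x : Σ n : ℕ, polysLT F n) :
    (sigmaPolysLTEquivMonic F x : F[X]).natDegree = x.1 := by
  change (X ^ x.1 + (x.2 : F[X])).natDegree = x.1
  refine natDegree_eq_of_degree_eq_some ?_
  rw [degree_add_eq_left_of_degree_lt, degree_X_pow]
  rw [degree_X_pow]
  exact mem_polysLT.1 x.2.2

/-- Series over monic polynomials may be summed degree by degree. -/
lemma hasSum_monic {a : F[X] → ℂ} (ha : ∀ f, ‖a f‖ ≤ 1) {u : ℂ}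
    (hu : ‖u‖ < 1 / Fintype.card F) {s : ℂ}
    (hs : HasSum (fun n : ℕ => u ^ n * ∑ f ∈ polysLT F n, a (X ^ n + f)) s) :
    HasSum (fun f : {f : F[X] // f.Monic} => a f * u ^ (f : F[X]).natDegree) s := by
  have hq : (0 : ℝ) < Fintype.card F := by exact_mod_cast Fintype.card_pos
  rw [← (sigmaPolysLTEquivMonic F).hasSum_iff]
  have hfun : ((fun f : {f : F[X] // f.Monic} => a f * u ^ (f : F[X]).natDegree) ∘
      sigmaPolysLTEquivMonic F) = fun x => a (X ^ x.1 + (x.2 : F[X])) * u ^ x.1 := by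
    funext x
    rw [Function.comp_apply, natDegree_sigmaPolysLTEquivMonic]
    rfl
  rw [hfun]
  refine HasSum.sigma_of_hasSum hs (fun n => ?_) (Summable.of_norm ?_)
  · have h := hasSum_fintype fun f : polysLT F n => a (X ^ n + (f : F[X])) * u ^ n
    rwa [Finset.sum_coe_sort (polysLT F n) fun f => a (X ^ n + f) * u ^ n, ← Finset.sum_mul,
      mul_comm] at h
  · rw [summable_sigma_of_nonneg fun _ => norm_nonneg _]
    refine ⟨fun n => Summable.of_finite, ?_⟩
    have hgeom : Summable fun n : ℕ => (Fintype.card F * ‖u‖) ^ n :=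
      summable_geometric_of_lt_one (by positivity) (by rwa [lt_div_iff₀' hq] at hu)
    refine Summable.of_nonneg_of_le (fun n => tsum_nonneg fun _ => norm_nonneg _) (fun n => ?_) hgeom
    rw [tsum_fintype]
    refine (Finset.sum_le_card_nsmul _ _ (‖u‖ ^ n) fun f _ => ?_).trans ?_
    · rw [norm_mul, norm_pow]
      exact mul_le_of_le_one_left (by positivity) (ha _)
    · rw [Finset.card_univ, Fintype.card_coe, card_polysLT, nsmul_eq_mul, mul_pow]
      push_cast
      rfl

lemma norm_card_mul_lt_one {u : ℂ} (hu : ‖u‖ < 1 / Fintype.card F) :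
    ‖(Fintype.card F : ℂ) * u‖ < 1 := by
  have hq : (0 : ℝ) < Fintype.card F := by exact_mod_cast Fintype.card_pos
  rw [norm_mul, Complex.norm_natCast]
  rwa [lt_div_iff₀' hq] at hu

lemma hasSum_eFrac_zero (h : F[X]) {u : ℂ} (hu : ‖u‖ < 1 / Fintype.card F) :
    HasSum (fun f : {f : F[X] // f.Monic} => eFrac ((f : F[X]) * 0) h * u ^ (f : F[X]).natDegree)
      (1 / (1 - Fintype.card F * u)) := by
  refine hasSum_monic (a := fun f : F[X] => eFrac (f * 0) h) (fun f => (norm_eFrac _ _).le) hu ?_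
  rw [one_div]
  refine (congrArg (fun s => HasSum s _) (funext fun n => ?_)).mpr
    (hasSum_geometric_of_norm_lt_one (norm_card_mul_lt_one hu))
  simp only [mul_zero, eFrac_eq_one_of_dvd (dvd_zero h)]
  simp [card_polysLT, mul_pow, mul_comm]

lemma hasSum_eFrac {h m : F[X]} (hm0 : m ≠ 0) (hm : m.degree < h.degree) {u : ℂ}
    (hu : ‖u‖ < 1 / Fintype.card F) :
    HasSum (fun f : {f : F[X] // f.Monic} => eFrac ((f : F[X]) * m) h * u ^ (f : F[X]).natDegree)
      (1 / (1 - Fintype.card F * u) + (Fintype.card F * u) ^ (h.natDegree - 1 - m.natDegree) *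
        (eChar F m.leadingCoeff - 1 / (1 - Fintype.card F * u))) := by
  refine hasSum_monic (a := fun f : F[X] => eFrac (f * m) h) (fun f => (norm_eFrac _ _).le) hu ?_
  have hk : m.natDegree < h.natDegree := natDegree_lt_natDegree hm0 hm
  have hw := norm_card_mul_lt_one hu
  have hw1 : (Fintype.card F : ℂ) * u ≠ 1 := fun e => by simp [e] at hw
  obtain ⟨j, hj⟩ := Nat.exists_eq_add_of_lt hk
  have hterm : ∀ n : ℕ, u ^ n * ∑ f ∈ polysLT F n, eFrac ((X ^ n + f) * m) h =
      if n < j then (Fintype.card F * u) ^ n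
      else if n = j then (Fintype.card F * u) ^ n * eChar F m.leadingCoeff else 0 := by
    intro n
    have e1 : n + 1 + m.natDegree < h.natDegree ↔ n < j := by omega
    have e2 : n + 1 + m.natDegree = h.natDegree ↔ n = j := by omega
    rw [sum_monic_eFrac hm0 hm]
    simp only [e1, e2]
    split_ifs <;> ring
  simp only [hterm]
  rw [show h.natDegree - 1 - m.natDegree = j by omega]
  convert hasSum_sum_of_ne_finset_zero (s := Finset.range (j + 1)) _ using 1
  · rw [Finset.sum_range_succ, Finset.sum_congr rfl fun n hn => if_pos (Finset.mem_range.1 hn),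
      if_neg (lt_irrefl j), if_pos rfl, geom_sum_eq hw1]
    have h1 : 1 - (Fintype.card F : ℂ) * u ≠ 0 := sub_ne_zero.2 (Ne.symm hw1)
    have h2 : (Fintype.card F : ℂ) * u - 1 ≠ 0 := sub_ne_zero.2 hw1
    rw [← neg_sub, div_neg]
    field_simp
    ring
  · intro n hn
    rw [Finset.mem_range] at hn
    rw [if_neg (by omega), if_neg (by omega)]
  · infer_instance

/-- A rational continuation is determined by its values on the disc of convergence. -/
lemma IsRatCont.eq_div {a : F[X] → ℂ} {φ : ℂ → ℂ} (hφ : IsRatCont a φ) {B D : ℂ[X]}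
    (h : ∀ v : ℂ, ‖v‖ < 1 / Fintype.card F → D.eval v * φ v = B.eval v) {v : ℂ}
    (hv : D.eval v ≠ 0) : φ v = B.eval v / D.eval v := by
  obtain ⟨⟨P, Q, hPQ, hQ, hφQ⟩, -⟩ := hφ
  have hq : (0 : ℝ) < Fintype.card F := by exact_mod_cast Fintype.card_pos
  have heq : P * D = B * Q := by
    have hinf : (Metric.ball (0 : ℂ) (1 / Fintype.card F) \ (Q.rootSet ℂ : Set ℂ)).Infinite :=
      (infinite_of_mem_nhds 0 (Metric.ball_mem_nhds 0 (by positivity))).sdiff (Q.rootSet_finite ℂ)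
    refine Polynomial.eq_of_infinite_eval_eq _ _ (hinf.mono fun z hz => ?_)
    have hQz : Q.eval z ≠ 0 := fun e => hz.2 ((mem_rootSet_of_ne hQ).2 (by simpa using e))
    have h1 := h z (by simpa using hz.1)
    rw [hφQ z hQz] at h1
    rw [Set.mem_ofPred_eq, eval_mul, eval_mul, ← h1]
    field_simp
  have hdvd : Q ∣ D := hPQ.symm.dvd_of_dvd_mul_left ⟨B, by rw [heq, mul_comm]⟩
  have hQv : Q.eval v ≠ 0 := fun e => hv (by
    obtain ⟨k, hk⟩ := hdvd
    rw [hk, eval_mul, e, zero_mul])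
  have h2 := congrArg (eval v) heq
  rw [eval_mul, eval_mul] at h2
  rw [hφQ v hQv, div_eq_div_iff hQv hv, h2]

end MonicSeries

section ResidueClasses

variable {F : Type} [Field F] [Fintype F]

/-- The conjugate of `χ` restricted to the residue class of `b` modulo `g`. -/
noncomputable def residueChar (χ : F[X] → ℂ) (g b f : F[X]) : ℂ :=
  if f % g = b % g then conjChar χ f else 0

lemma norm_residueChar_le_one {ℓ : F[X]} {χ : F[X] → ℂ} (hχ : IsDirichletChar ℓ χ)
    (hℓ : ℓ.Monic) (g b f : F[X]) : ‖residueChar χ g b f‖ ≤ 1 := by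
  rw [residueChar]
  split_ifs
  · rw [conjChar, Complex.norm_conj]
    exact hχ.norm_le_one hℓ f
  · simp

omit [Fintype F] in
lemma residueChar_congr {ℓ : F[X]} {χ : F[X] → ℂ} (hχ : IsDirichletChar ℓ χ) {g b x y : F[X]}
    (h : x % (g * ℓ) = y % (g * ℓ)) : residueChar χ g b x = residueChar χ g b y := by
  rw [residueChar, residueChar, mod_congr_of_dvd (dvd_mul_right g ℓ) h, conjChar, conjChar,
    hχ.1 x y (mod_congr_of_dvd (dvd_mul_left ℓ g) h)]

omit [Fintype F] in
lemma IsDirichletChar.eq_one {χ : F[X] → ℂ} (hχ : IsDirichletChar 1 χ) (f : F[X]) : χ f = 1 := by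
  rw [← hχ.2.2.1]
  exact hχ.1 _ _ (by simp)

/-- Picking out a residue class in the division-with-remainder decomposition. -/
lemma sum_residue_class {g : F[X]} (hg : g.Monic) (n : ℕ) (b : F[X]) (ψ : F[X] → ℂ) :
    ∑ m ∈ polysLT F (g.natDegree + n), (if m % g = b % g then ψ m else 0) =
      ∑ s ∈ polysLT F n, ψ (b % g + g * s) := by
  have hd : g.degree = (g.natDegree : WithBot ℕ) := degree_eq_natDegree hg.ne_zero
  rw [sum_polysLT_add hg, Finset.sum_eq_single (b % g)]
  · refine Finset.sum_congr rfl fun s _ => if_pos ?_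
    refine Polynomial.mod_eq_of_dvd_sub ⟨s - b / g, ?_⟩
    linear_combination EuclideanDomain.mod_add_div b g
  · intro r hr hne
    refine Finset.sum_eq_zero fun s _ => if_neg fun h => hne ?_
    rw [← h, Polynomial.mod_eq_of_dvd_sub (p₂ := r) ⟨s, by ring⟩,
      (Polynomial.mod_eq_self_iff hg.ne_zero).2 (hd ▸ mem_polysLT.1 hr)]
  · intro h
    rw [mem_polysLT, ← hd] at h
    exact absurd (Polynomial.degree_mod_lt b hg.ne_zero) h

/-- The complete sum of a primitive character over a residue class. -/
lemma IsPrimitiveChar.sum_residueChar {g ℓ : F[X]} {χ : F[X] → ℂ} (hχ : IsPrimitiveChar ℓ χ)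
    (hg : g.Monic) (hℓ : ℓ.Monic) (hcop : IsCoprime ℓ g) (b : F[X]) :
    ∑ m ∈ polysLT F (g * ℓ).natDegree, residueChar χ g b m = if ℓ = 1 then 1 else 0 := by
  split_ifs with h1
  · subst h1
    rw [mul_one]
    simp only [residueChar]
    rw [← add_zero g.natDegree, sum_residue_class hg 0 b, polysLT_zero, Finset.sum_singleton,
      conjChar, hχ.1.eq_one, map_one]
  · obtain ⟨a, ha, -, hχa⟩ := hχ.exists_ne_one hℓ monic_one (one_dvd ℓ) (Ne.symm h1)
    obtain ⟨x, y, hxy⟩ := hcop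
    set a' := a * (y * g) + x * ℓ with ha'
    have hal : a' % ℓ = a % ℓ := Polynomial.mod_eq_of_dvd_sub
      ⟨x - a * x, by rw [ha']; linear_combination a * hxy⟩
    have hag : g ∣ a' - 1 := ⟨a * y - y, by rw [ha']; linear_combination hxy⟩
    have hcl : IsCoprime a' ℓ := (isCoprime_iff_of_mod_eq hal).2 ha
    have hcg : IsCoprime a' g := by
      obtain ⟨k, hk⟩ := hag
      exact ⟨1, -k, by linear_combination hk⟩
    have hs := sum_polysLT_mul (hg.mul hℓ) (hcg.mul_right hcl) (φ := residueChar χ g b)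
      fun x y h => residueChar_congr hχ.1 h
    have hmul : ∀ f, residueChar χ g b (a' * f) = conjChar χ a * residueChar χ g b f := by
      intro f
      have hm : (a' * f) % g = f % g := by
        obtain ⟨k, hk⟩ := hag
        exact Polynomial.mod_eq_of_dvd_sub ⟨k * f, by linear_combination f * hk⟩
      rw [residueChar, residueChar, hm, conjChar_mul hχ.1, mul_ite, mul_zero, conjChar,
        hχ.1.1 _ _ hal]
      rfl
    simp only [hmul, ← Finset.mul_sum] at hs
    have h' : (conjChar χ a - 1) *
        ∑ m ∈ polysLT F (g * ℓ).natDegree, residueChar χ g b m = 0 := by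
      linear_combination hs
    refine (mul_eq_zero.1 h').resolve_left fun h => hχa ?_
    have := congrArg (starRingEnd ℂ) (sub_eq_zero.1 h)
    simpa [conjChar] using this

/-- The coefficient of `u ^ n` in the series of `residueChar`. -/
noncomputable def residueCoeff (χ : F[X] → ℂ) (g b : F[X]) (n : ℕ) : ℂ :=
  ∑ f ∈ polysLT F n, residueChar χ g b (X ^ n + f)

lemma residueCoeff_add {g ℓ : F[X]} {χ : F[X] → ℂ} (hχ : IsDirichletChar ℓ χ)
    (hg : g.Monic) (hℓ : ℓ.Monic) (b : F[X]) (j : ℕ) :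
    residueCoeff χ g b (j + (g * ℓ).natDegree) = (Fintype.card F : ℂ) ^ j *
      ∑ m ∈ polysLT F (g * ℓ).natDegree, residueChar χ g b m := by
  have hh := hg.mul hℓ
  rw [residueCoeff, add_comm j, sum_polysLT_monic_center (p := g * ℓ * X ^ j)
    (hh.mul (monic_X_pow j)) (by rw [hh.natDegree_mul (monic_X_pow j), natDegree_X_pow]),
    sum_polysLT_add hh, Finset.mul_sum]
  refine Finset.sum_congr rfl fun r _ => ?_
  rw [Finset.sum_congr rfl fun s _ => residueChar_congr hχ (y := r)
    (Polynomial.mod_eq_of_dvd_sub ⟨X ^ j + s, by ring⟩)]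
  simp [card_polysLT]

lemma hasSum_residueChar {g ℓ : F[X]} {χ : F[X] → ℂ} (hχ : IsDirichletChar ℓ χ)
    (hg : g.Monic) (hℓ : ℓ.Monic) (b : F[X]) {v : ℂ} (hv : ‖v‖ < 1 / Fintype.card F) :
    HasSum (fun f : {f : F[X] // f.Monic} => residueChar χ g b f * v ^ (f : F[X]).natDegree)
      ((∑ m ∈ polysLT F (g * ℓ).natDegree, residueChar χ g b m) * v ^ (g * ℓ).natDegree *
          (1 - Fintype.card F * v)⁻¹ +
        ∑ k ∈ Finset.range (g * ℓ).natDegree, v ^ k * residueCoeff χ g b k) := by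
  refine hasSum_monic (norm_residueChar_le_one hχ hℓ g b) hv ?_
  refine (hasSum_nat_add_iff (f := fun n => v ^ n * residueCoeff χ g b n)
    (g * ℓ).natDegree).1 ?_
  refine (congrArg (fun s => HasSum s _) (funext fun n => ?_)).mpr
    ((hasSum_geometric_of_norm_lt_one (norm_card_mul_lt_one hv)).mul_left _)
  rw [residueCoeff_add hχ hg hℓ]
  ring

/-- The rational continuation of the series of `residueChar`. -/
lemma IsRatCont.eq_residueChar {g ℓ : F[X]} {χ : F[X] → ℂ} (hχ : IsDirichletChar ℓ χ)
    (hg : g.Monic) (hℓ : ℓ.Monic) {b : F[X]} {φ : ℂ → ℂ} (hφ : IsRatCont (residueChar χ g b) φ)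
    {v : ℂ} (hv : 1 - Fintype.card F * v ≠ 0) :
    φ v = (∑ m ∈ polysLT F (g * ℓ).natDegree, residueChar χ g b m) * v ^ (g * ℓ).natDegree *
          (1 - Fintype.card F * v)⁻¹ +
        ∑ k ∈ Finset.range (g * ℓ).natDegree, v ^ k * residueCoeff χ g b k := by
  set E := ∑ m ∈ polysLT F (g * ℓ).natDegree, residueChar χ g b m with hE
  let D : ℂ[X] := 1 - C (Fintype.card F : ℂ) * X
  let B : ℂ[X] := C E * X ^ (g * ℓ).natDegree +
    D * ∑ k ∈ Finset.range (g * ℓ).natDegree, X ^ k * C (residueCoeff χ g b k)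
  have hDe : ∀ z, D.eval z = 1 - Fintype.card F * z := fun z => by simp [D]
  have hBe : ∀ z, B.eval z = E * z ^ (g * ℓ).natDegree + (1 - Fintype.card F * z) *
      ∑ k ∈ Finset.range (g * ℓ).natDegree, z ^ k * residueCoeff χ g b k := fun z => by
    simp only [B, eval_add, eval_mul, hDe, eval_C, eval_pow, eval_X, eval_finsetSum]
  rw [hφ.eq_div (B := B) (D := D) _ (by rwa [hDe]), hBe, hDe]
  · field_simp
  · intro z hz
    have hz1 : 1 - (Fintype.card F : ℂ) * z ≠ 0 := by
      have := norm_card_mul_lt_one hz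
      intro e
      rw [← sub_eq_zero.1 e] at this
      simp at this
    rw [(hφ.2 z hz).unique (hasSum_residueChar hχ hg hℓ b hz), hBe, hDe, ← hE]
    field_simp

end ResidueClasses

section FunctionalEquation

variable {F : Type} [Field F] [Fintype F]

/-- An additive character summed over a residue class modulo `g`. -/
lemma sum_residue_class_eFrac {g ℓ : F[X]} (hg : g.Monic) (hℓ : ℓ.Monic) (c y : F[X]) :
    ∑ m ∈ polysLT F (g * ℓ).natDegree,
        (if m % g = (c * ℓ) % g then eFrac (y * m) (g * ℓ) else 0) =
      eFrac (y * c) g * if ℓ ∣ y then (Fintype.card F : ℂ) ^ ℓ.natDegree else 0 := by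
  have hsplit : ∀ s, eFrac (y * ((c * ℓ) % g + g * s)) (g * ℓ) =
      eFrac (y * c) g * (eFrac (-((c * ℓ / g)) * y) ℓ * eFrac (s * y) ℓ) := by
    intro s
    rw [show y * ((c * ℓ) % g + g * s) = (y * c) * ℓ + (-(c * ℓ / g) * y + s * y) * g by
      linear_combination y * EuclideanDomain.mod_add_div (c * ℓ) g, eFrac_add,
      eFrac_mul_mul hg hℓ, mul_comm g ℓ, eFrac_mul_mul hℓ hg, eFrac_add]
  rw [hg.natDegree_mul hℓ, sum_residue_class hg]
  simp only [hsplit, ← Finset.mul_sum, sum_eFrac_mul hℓ]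
  split_ifs with hy
  · rw [eFrac_eq_one_of_dvd (hy.mul_left _), one_mul]
  · simp

/-- The Fourier expansion of the twisted summand. -/
lemma IsPrimitiveChar.fourier_expansion {g ℓ : F[X]} {χ : F[X] → ℂ} (hχ : IsPrimitiveChar ℓ χ)
    (hg : g.Monic) (hℓ : ℓ.Monic) (hcop : IsCoprime ℓ g) (c f : F[X]) :
    (Fintype.card F : ℂ) ^ ℓ.natDegree * (χ f * eFrac (c * f) g) =
      χ (-1) * χ g * GSum ℓ χ * ∑ m ∈ polysLT F (g * ℓ).natDegree,
        residueChar χ g (c * ℓ) m * eFrac (f * m) (g * ℓ) := by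
  have hper := hχ.1.1
  have hmul := hχ.1.2.1
  have hterm : ∀ m, GSum ℓ χ * (residueChar χ g (c * ℓ) m * eFrac (f * m) (g * ℓ)) =
      ∑ a ∈ polysLT F ℓ.natDegree, χ a *
        (if m % g = (c * ℓ) % g then eFrac ((g * a + f) * m) (g * ℓ) else 0) := by
    intro m
    rw [residueChar]
    split_ifs
    · rw [← mul_assoc, ← hχ.sum_mul_eFrac hℓ, Finset.sum_mul]
      refine Finset.sum_congr rfl fun a _ => ?_
      rw [add_mul, eFrac_add, show g * a * m = a * m * g by ring, mul_comm g ℓ,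
        eFrac_mul_mul hℓ hg, mul_assoc]
    · simp
  have hy : ∀ a, eFrac ((g * a + f) * c) g = eFrac (c * f) g := fun a =>
    eFrac_congr (Polynomial.mod_eq_of_dvd_sub ⟨a * c, by ring⟩)
  have hd : ℓ.degree = (ℓ.natDegree : WithBot ℕ) := degree_eq_natDegree hℓ.ne_zero
  have hsum : χ g * ∑ a ∈ polysLT F ℓ.natDegree, χ a * (if ℓ ∣ g * a + f then (1 : ℂ) else 0) =
      χ (-f) := by
    have h1 := sum_polysLT_mul hℓ hcop.symm
      (φ := fun a => χ a * (if ℓ ∣ a + f then (1 : ℂ) else 0)) fun x y h => by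
        have e : ℓ ∣ x + f ↔ ℓ ∣ y + f := by
          rw [← EuclideanDomain.mod_eq_zero, ← EuclideanDomain.mod_eq_zero, Polynomial.add_mod, h,
            ← Polynomial.add_mod]
        simp only [hper x y h, e]
    simp only [hmul, mul_assoc, ← Finset.mul_sum] at h1
    rw [h1, Finset.sum_eq_single ((-f) % ℓ)]
    · rw [if_pos, mul_one]
      · refine hper _ _ ((Polynomial.mod_eq_self_iff hℓ.ne_zero).2 ?_)
        exact Polynomial.degree_mod_lt _ hℓ.ne_zero
      · exact ⟨-(-f / ℓ), by linear_combination EuclideanDomain.mod_add_div (-f) ℓ⟩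
    · intro a ha hne
      rw [if_neg, mul_zero]
      intro hdvd
      apply hne
      rw [← Polynomial.mod_eq_of_dvd_sub (p₁ := a) (by simpa using hdvd),
        (Polynomial.mod_eq_self_iff hℓ.ne_zero).2 (hd ▸ mem_polysLT.1 ha)]
    · intro h
      rw [mem_polysLT, ← hd] at h
      exact absurd (Polynomial.degree_mod_lt _ hℓ.ne_zero) h
  have hneg : χ (-1) * χ (-f) = χ f := by
    rw [← hmul]
    congr 1
    ring
  rw [mul_assoc, Finset.mul_sum, Finset.sum_congr rfl fun m _ => hterm m, Finset.sum_comm]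
  simp only [← Finset.mul_sum, sum_residue_class_eFrac hg hℓ, hy]
  have hpull : ∑ a ∈ polysLT F ℓ.natDegree, χ a * (eFrac (c * f) g *
      if ℓ ∣ g * a + f then (Fintype.card F : ℂ) ^ ℓ.natDegree else 0) =
      eFrac (c * f) g * (Fintype.card F : ℂ) ^ ℓ.natDegree *
        ∑ a ∈ polysLT F ℓ.natDegree, χ a * (if ℓ ∣ g * a + f then (1 : ℂ) else 0) := by
    rw [Finset.mul_sum]
    refine Finset.sum_congr rfl fun a _ => ?_
    split_ifs <;> ring
  rw [hpull]
  linear_combination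
    -((Fintype.card F : ℂ) ^ ℓ.natDegree * eFrac (c * f) g) * hneg -
      (χ (-1) * eFrac (c * f) g * (Fintype.card F : ℂ) ^ ℓ.natDegree) * hsum

omit [Fintype F] in
lemma isCoprime_C_left {x : F} (hx : x ≠ 0) (f : F[X]) : IsCoprime (C x) f :=
  ⟨C x⁻¹, 0, by rw [zero_mul, add_zero, ← C_mul, inv_mul_cancel₀ hx, C_1]⟩

/-- Rescaling the argument of `residueChar` by a constant. -/
lemma residueChar_C_inv_mul {g ℓ : F[X]} {χ : F[X] → ℂ} (hχ : IsDirichletChar ℓ χ)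
    (hℓ : ℓ.Monic) (b f : F[X]) (lam : Fˣ) :
    residueChar χ g b (C ((lam⁻¹ : Fˣ) : F) * f) =
      χ (C (lam : F)) * residueChar χ g (C (lam : F) * b) f := by
  have hinv : C (lam : F) * C ((lam⁻¹ : Fˣ) : F) = 1 := by
    rw [← C_mul, Units.mul_inv, C_1]
  have hcond : (C ((lam⁻¹ : Fˣ) : F) * f) % g = b % g ↔ f % g = (C (lam : F) * b) % g := by
    constructor <;> intro h
    · rw [← mul_mod_congr _ h, ← mul_assoc, hinv, one_mul]
    · rw [mul_mod_congr _ h, ← mul_assoc, mul_comm (C _), hinv, one_mul]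
  simp only [residueChar, hcond, conjChar_mul hχ, mul_ite, mul_zero]
  congr 2
  have h1 : conjChar χ (C (lam : F)) * conjChar χ (C ((lam⁻¹ : Fˣ) : F)) = 1 := by
    rw [← conjChar_mul hχ, hinv, conjChar, hχ.2.2.1, map_one]
  have h2 := hχ.mul_conjChar hℓ (isCoprime_C_left lam.ne_zero ℓ)
  linear_combination χ (C (lam : F)) * h1 - conjChar χ (C ((lam⁻¹ : Fˣ) : F)) * h2

/-- The twisted series as a finite sum over a residue class. -/
lemma IsPrimitiveChar.monicSeries_eq {g ℓ : F[X]} {χ : F[X] → ℂ} (hχ : IsPrimitiveChar ℓ χ)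
    (hg : g.Monic) (hℓ : ℓ.Monic) (hcop : IsCoprime ℓ g) (c : F[X]) {u : ℂ}
    (hu : ‖u‖ < 1 / Fintype.card F) :
    (Fintype.card F : ℂ) ^ ℓ.natDegree * monicSeries (fun f => χ f * eFrac (c * f) g) u =
      χ (-1) * χ g * GSum ℓ χ *
        ((if ℓ = 1 then 1 else 0) * (1 / (1 - Fintype.card F * u)) +
          ∑ lam : Fˣ, χ (C (lam : F)) *
            (eChar F ((lam⁻¹ : Fˣ) : F) - 1 / (1 - Fintype.card F * u)) *
            ∑ k ∈ Finset.range (g * ℓ).natDegree,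
              (Fintype.card F * u) ^ ((g * ℓ).natDegree - 1 - k) *
                residueCoeff χ g (C (lam : F) * (c * ℓ)) k) := by
  have hh := hg.mul hℓ
  have hd : (g * ℓ).degree = ((g * ℓ).natDegree : WithBot ℕ) := degree_eq_natDegree hh.ne_zero
  set N := (g * ℓ).natDegree with hN
  set w : ℂ := Fintype.card F * u with hw
  let K : F[X] → ℂ := fun m => if m = 0 then 1 / (1 - w) else
    1 / (1 - w) + w ^ (N - 1 - m.natDegree) * (eChar F m.leadingCoeff - 1 / (1 - w))
  have hK : ∀ m ∈ polysLT F N, HasSum (fun f : {f : F[X] // f.Monic} =>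
      eFrac ((f : F[X]) * m) (g * ℓ) * u ^ (f : F[X]).natDegree) (K m) := by
    intro m hm
    by_cases hm0 : m = 0
    · subst hm0
      simpa only [K, if_true] using hasSum_eFrac_zero (g * ℓ) hu
    · simpa only [K, if_neg hm0] using hasSum_eFrac hm0 (hd ▸ mem_polysLT.1 hm) hu
  have hseries : (Fintype.card F : ℂ) ^ ℓ.natDegree *
      monicSeries (fun f => χ f * eFrac (c * f) g) u =
      χ (-1) * χ g * GSum ℓ χ * ∑ m ∈ polysLT F N, residueChar χ g (c * ℓ) m * K m := by
    rw [monicSeries, ← tsum_mul_left]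
    refine HasSum.tsum_eq ((congrArg (fun s => HasSum s _) (funext fun f => ?_)).mpr
      ((hasSum_sum fun m hm => (hK m hm).mul_left (residueChar χ g (c * ℓ) m)).mul_left
        (χ (-1) * χ g * GSum ℓ χ)))
    rw [← mul_assoc, hχ.fourier_expansion hg hℓ hcop c, mul_assoc, Finset.sum_mul]
    simp only [mul_assoc, ← hN]
  rw [hseries]
  congr 1
  have hcomplete := hχ.sum_residueChar hg hℓ hcop (c * ℓ)
  have h0 : (0 : F[X]) ∈ polysLT F N := by simp
  rw [← hcomplete, ← Finset.add_sum_erase _ _ h0,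
    ← Finset.add_sum_erase _ (residueChar χ g (c * ℓ)) h0, add_mul, Finset.sum_mul, add_assoc]
  refine congrArg₂ (· + ·) (congrArg _ (if_pos rfl)) ?_
  have hsplit : ∀ m ∈ (polysLT F N).erase 0, residueChar χ g (c * ℓ) m * K m =
      residueChar χ g (c * ℓ) m * (1 / (1 - w)) + residueChar χ g (c * ℓ) m *
        (w ^ (N - 1 - m.natDegree) * (eChar F m.leadingCoeff - 1 / (1 - w))) := by
    intro m hm
    simp only [K, if_neg (Finset.ne_of_mem_erase hm), mul_add]
  rw [Finset.sum_congr rfl hsplit, Finset.sum_add_distrib, sum_polysLT_erase_zero N fun m =>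
    residueChar χ g (c * ℓ) m *
      (w ^ (N - 1 - m.natDegree) * (eChar F m.leadingCoeff - 1 / (1 - w)))]
  congr 1
  refine Finset.sum_congr rfl fun lam _ => ?_
  rw [Finset.mul_sum]
  refine Finset.sum_congr rfl fun k _ => ?_
  rw [residueCoeff, Finset.mul_sum, Finset.mul_sum]
  refine Finset.sum_congr rfl fun f hf => ?_
  rw [mem_polysLT] at hf
  have hmon : (X ^ k + f).Monic := monic_X_pow_add hf
  have hdeg : (X ^ k + f).natDegree = k := natDegree_eq_of_degree_eq_some (by
    rw [degree_add_eq_left_of_degree_lt (by rwa [degree_X_pow]), degree_X_pow])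
  rw [residueChar_C_inv_mul hχ.1 hℓ, natDegree_C_mul (Units.ne_zero _), hdeg, leadingCoeff_mul,
    leadingCoeff_C, hmon.leadingCoeff, mul_one]
  ring

end FunctionalEquation

/-- **Functional equation for the character-twisted series `R_1(u;χ,c/g)`**
(`gcd(ℓ,g) = 1`): for `0 < |u| < 1/q`,
`R_1(u;χ,c/g) = χ(g)G(χ)(qu)^{deg g - 1}u^{deg ℓ}
  Σ_{λ} χ(-λ)[e_q(λ⁻¹) - 1/(1-qu)]·Z_{χ̄}(1/(qu); λcℓ, g)`,
with `Z_{χ̄}` evaluated via its rational continuation. -/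
theorem twistedR1_functional_equation
    (F : Type) [Field F] [Fintype F] (q : ℕ) (hq : q = Fintype.card F)
    (g ℓ : Polynomial F) (hg : g.Monic) (hℓ : ℓ.Monic) (hcop : IsCoprime ℓ g)
    (c : Polynomial F) (χ : Polynomial F → ℂ) (hχ : IsPrimitiveChar ℓ χ)
    (φ : Fˣ → ℂ → ℂ)
    (hφ : ∀ lam : Fˣ,
      IsRatCont
        (fun f => if f % g = (Polynomial.C (lam : F) * c * ℓ) % g then conjChar χ f else 0)
        (φ lam))
    (u : ℂ) (hu0 : 0 < ‖u‖) (hu : ‖u‖ < 1 / q) :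
    monicSeries (fun f => χ f * eFrac (c * f) g) u =
      χ g * GSum ℓ χ * ((q : ℂ) * u) ^ ((g.natDegree : ℤ) - 1) * u ^ ℓ.natDegree *
        ∑ lam : Fˣ,
          χ (Polynomial.C (-(lam : F))) *
            (eChar F (((lam⁻¹ : Fˣ) : F)) - 1 / (1 - (q : ℂ) * u)) *
            φ lam (1 / ((q : ℂ) * u)) := by
  subst hq
  have hq0 : (Fintype.card F : ℂ) ≠ 0 := by exact_mod_cast Fintype.card_ne_zero
  have hu0' : u ≠ 0 := norm_pos_iff.1 hu0
  have hlt := norm_card_mul_lt_one hu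
  have hseries := hχ.monicSeries_eq hg hℓ hcop c hu
  have hnear : 1 - (Fintype.card F : ℂ) * (1 / (Fintype.card F * u)) ≠ 0 := by
    have hu1 : u ≠ 1 := by
      rintro rfl
      have : (1 : ℝ) ≤ Fintype.card F := by exact_mod_cast Fintype.card_pos
      rw [mul_one, Complex.norm_natCast] at hlt
      linarith
    rw [mul_one_div, ← div_div, div_self hq0]
    exact sub_ne_zero.2 fun e => hu1 (by field_simp at e; exact e)
  have hcont : ∀ lam : Fˣ, φ lam (1 / (Fintype.card F * u)) = _ := fun lam =>
    IsRatCont.eq_residueChar (b := C (lam : F) * c * ℓ) hχ.1 hg hℓ (hφ lam) hnear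
  set w : ℂ := Fintype.card F * u with hw
  set W : ℂ := w ^ (((g * ℓ).natDegree : ℤ) - 1) with hWdef
  have hw0 : w ≠ 0 := mul_ne_zero hq0 hu0'
  have hneg : ∀ lam : Fˣ, χ (C (-(lam : F))) = χ (-1) * χ (C (lam : F)) := fun lam => by
    rw [← hχ.1.2.1, C_neg, neg_one_mul]
  have hW : (Fintype.card F : ℂ) ^ ℓ.natDegree * (w ^ ((g.natDegree : ℤ) - 1) * u ^ ℓ.natDegree) =
      W := by
    rw [hWdef, hg.natDegree_mul hℓ, mul_left_comm, ← mul_pow, ← hw, ← zpow_natCast w,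
      ← zpow_add₀ hw0]
    congr 1
    push_cast
    ring
  have hWk : ∀ k ∈ Finset.range (g * ℓ).natDegree,
      w ^ ((g * ℓ).natDegree - 1 - k) = W * (1 / w) ^ k := by
    intro k hk
    rw [Finset.mem_range] at hk
    rw [hWdef, one_div, inv_pow, ← zpow_natCast w k, ← zpow_neg, ← zpow_add₀ hw0, ← zpow_natCast]
    congr 1
    omega
  have hWN : W * (1 / w) ^ (g * ℓ).natDegree = 1 / w := by
    rw [hWdef, one_div, inv_pow, ← zpow_natCast w, ← zpow_neg, ← zpow_add₀ hw0, ← zpow_neg_one]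
    congr 1
    ring
  have hE : (if ℓ = 1 then (1 : ℂ) else 0) * (1 / (1 - w)) =
      (if ℓ = 1 then (1 : ℂ) else 0) * (1 / w * (1 - Fintype.card F * (1 / w))⁻¹) *
        ∑ lam : Fˣ, χ (C (lam : F)) * (eChar F ((lam⁻¹ : Fˣ) : F) - 1 / (1 - w)) := by
    split_ifs with h1
    · subst h1
      have hcard : (Fintype.card Fˣ : ℂ) = Fintype.card F - 1 := by
        rw [Fintype.card_units, Nat.cast_pred Fintype.card_pos]
      have hw1 : 1 - w ≠ 0 := sub_ne_zero.2 fun e => by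
        rw [← e, norm_one] at hlt
        exact lt_irrefl _ hlt
      simp only [hχ.1.eq_one, one_mul, Finset.sum_sub_distrib, sum_eChar_units_inv,
        Finset.sum_const, Finset.card_univ, nsmul_eq_mul, hcard]
      have hwq : w - Fintype.card F ≠ 0 := fun e => hnear (by
        rw [mul_one_div, ← sub_eq_zero.1 e, div_self hw0, sub_self])
      rw [show (1 : ℂ) - Fintype.card F * (1 / w) = (w - Fintype.card F) / w by field_simp]
      field_simp
      ring
    · simp
  refine mul_left_cancel₀ (pow_ne_zero ℓ.natDegree hq0) (hseries.trans ?_)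
  simp only [hcont, hneg, hχ.sum_residueChar hg hℓ hcop, mul_assoc (C _) c ℓ]
  rw [hE, mul_assoc _ _ (∑ lam : Fˣ, _), Finset.mul_sum, Finset.mul_sum,
    ← Finset.sum_add_distrib, Finset.mul_sum, Finset.mul_sum, Finset.mul_sum]
  refine Finset.sum_congr rfl fun lam _ => ?_
  rw [Finset.sum_congr rfl fun k hk => congrArg (· * _) (hWk k hk)]
  simp only [mul_assoc W, ← Finset.mul_sum]
  generalize (∑ k ∈ Finset.range (g * ℓ).natDegree,
    (1 / w) ^ k * residueCoeff χ g (C (lam : F) * (c * ℓ)) k) = S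
  generalize (1 - (Fintype.card F : ℂ) * (1 / w))⁻¹ = D
  set E : ℂ := if ℓ = 1 then 1 else 0
  set A := χ (-1) * χ g * GSum ℓ χ *
    (χ (C (lam : F)) * (eChar F ((lam⁻¹ : Fˣ) : F) - 1 / (1 - w)))
  linear_combination -A * E * D * hWN - A * (E * (1 / w) ^ (g * ℓ).natDegree * D + S) * hW
end
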